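/- arXiv:1505.00952 — 9 statements merged into one kernel-verified Lean document; each statement's English description precedes it below -/
import Mathlib

section
/- If S is a strict cutset of a D-graph D, then the componential graph C_S(D) has at least two componential extremes. -/
/-- A graph in the sense of the paper: a finite set of edges, a finite set of
vertices, and West/East end functions (values outside `A` are irrelevant junk,
canonically `0`). -/
structure DGr where
  A : Finset ℕ
  V : Finset ℕ
  W : ℕ → ℕ
  E : ℕ → ℕ

namespace DGr

/-- The `X`-end function of a graph: `true` stands for `W`, `false` for `E`. -/
def Xf (G : DGr) : Bool → ℕ → ℕ
  | true => G.W
  | false => G.E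

/-- `vs`/`es` form a semiwalk: alternating vertices and edges, each edge joining
its two neighbouring vertices in one of the two directions. -/
def IsSemiwalk (G : DGr) (vs es : List ℕ) : Prop :=
  vs.length = es.length + 1 ∧
  (∀ v ∈ vs, v ∈ G.V) ∧ (∀ a ∈ es, a ∈ G.A) ∧
  ∀ (i a u v : ℕ), es[i]? = some a → vs[i]? = some u → vs[i + 1]? = some v →
    (G.W a = u ∧ G.E a = v) ∨ (G.W a = v ∧ G.E a = u)

/-- A semipath is a semiwalk with no repeated vertex. -/
def IsSemipath (G : DGr) (vs es : List ℕ) : Prop :=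
  G.IsSemiwalk vs es ∧ vs.Nodup

/-- A semipath from `u` to `v`. -/
def SemipathFT (G : DGr) (u v : ℕ) (vs es : List ℕ) : Prop :=
  G.IsSemipath vs es ∧ vs.head? = some u ∧ vs.getLast? = some v

/-- A walk: all edges traversed from West to East. -/
def IsWalk (G : DGr) (vs es : List ℕ) : Prop :=
  vs.length = es.length + 1 ∧
  (∀ v ∈ vs, v ∈ G.V) ∧ (∀ a ∈ es, a ∈ G.A) ∧
  ∀ (i a u v : ℕ), es[i]? = some a → vs[i]? = some u → vs[i + 1]? = some v →
    G.W a = u ∧ G.E a = v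

/-- A cycle: a non-trivial closed walk with no repeated vertex except endpoints. -/
def IsCycle (G : DGr) (vs es : List ℕ) : Prop :=
  G.IsWalk vs es ∧ es ≠ [] ∧ vs.head? = vs.getLast? ∧ vs.dropLast.Nodup

def Acyclic (G : DGr) : Prop := ∀ vs es, ¬ G.IsCycle vs es

def WeaklyConnected (G : DGr) : Prop :=
  ∀ u ∈ G.V, ∀ v ∈ G.V, u ≠ v → ∃ vs es, G.SemipathFT u v vs es

/-- `v` is an `X`-vertex: no edge has its `X̄`-end at `v`. -/
def XVertex (G : DGr) (X : Bool) (v : ℕ) : Prop :=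
  v ∈ G.V ∧ ∀ a ∈ G.A, G.Xf (!X) a ≠ v

def InnerVertex (G : DGr) (v : ℕ) : Prop :=
  v ∈ G.V ∧ ¬ G.XVertex true v ∧ ¬ G.XVertex false v

/-- `a` is an `X`-edge: its `X`-end is an `X`-vertex. -/
def XEdge (G : DGr) (X : Bool) (a : ℕ) : Prop :=
  a ∈ G.A ∧ G.XVertex X (G.Xf X a)

def InnerEdge (G : DGr) (a : ℕ) : Prop :=
  a ∈ G.A ∧ ¬ G.XEdge true a ∧ ¬ G.XEdge false a

def WEFunctional (G : DGr) : Prop :=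
  ∀ (X : Bool) (a : ℕ), G.XEdge X a → ∀ b ∈ G.A, b ≠ a → G.Xf X b ≠ G.Xf X a

def WellFormed (G : DGr) : Prop := ∀ a ∈ G.A, G.W a ∈ G.V ∧ G.E a ∈ G.V

/-- A D-graph: finite (built in), acyclic, W-E-functional, weakly connected
graph with an inner vertex. -/
def IsDGraph (G : DGr) : Prop :=
  G.WellFormed ∧ G.Acyclic ∧ G.WEFunctional ∧ G.WeaklyConnected ∧ ∃ v, G.InnerVertex v

/-- A basic D-graph: a D-graph with a single inner vertex. -/
def IsBasicDGraph (G : DGr) : Prop :=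
  G.IsDGraph ∧ ∃! v, G.InnerVertex v

/-- `ψ_X(v,u,w)`: every semipath in `[v,w]` and every semipath in `[u]_{X̄}`
intersect. -/
def psi (G : DGr) (X : Bool) (v u w : ℕ) : Prop :=
  ∀ vs₁ es₁, G.SemipathFT v w vs₁ es₁ →
    ∀ t vs₂ es₂, G.XVertex (!X) t → G.SemipathFT u t vs₂ es₂ →
      ∃ z, z ∈ vs₁ ∧ z ∈ vs₂

/-- `y ▷ [x,z]`: `y` occurs in every semipath from `x` to `z`. -/
def inAll (G : DGr) (y x z : ℕ) : Prop :=
  ∀ vs es, G.SemipathFT x z vs es → y ∈ vs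

/-- `y ≺ x`: `y` is a pivot of `x` (`y` occurs in every semipath in `[x]_W`). -/
def Pivot (G : DGr) (y x : ℕ) : Prop :=
  y ≠ x ∧ ∀ t vs es, G.XVertex true t → G.SemipathFT x t vs es → y ∈ vs

/-- `y ≺_∃ x`: `y` occurs in some semipath in `[x]_W`. -/
def PivotE (G : DGr) (y x : ℕ) : Prop :=
  y ≠ x ∧ ∃ t vs es, G.XVertex true t ∧ G.SemipathFT x t vs es ∧ y ∈ vs

/-- `v CCP(x,y)`: `v` is the closest common pivot of `x` and `y`. -/
def CCP (G : DGr) (v x y : ℕ) : Prop :=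
  G.Pivot v x ∧ G.Pivot v y ∧ ∀ w, G.Pivot w x → G.Pivot w y → (G.Pivot w v ∨ w = v)

end DGr
/-- `x` precedes `y` in the list `L`. -/
def ltL (L : List ℕ) (x y : ℕ) : Prop :=
  ∃ i j : ℕ, i < j ∧ L[i]? = some x ∧ L[j]? = some y

/-- `L : x−y−z`: `x`, `y`, `z` occur in `L` in that order or in the reverse order. -/
def BtwL (L : List ℕ) (x y z : ℕ) : Prop :=
  (ltL L x y ∧ ltL L y z) ∨ (ltL L z y ∧ ltL L y x)

/-- `L : x−y−u−z`. -/
def Btw4L (L : List ℕ) (x y u z : ℕ) : Prop :=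
  (ltL L x y ∧ ltL L y u ∧ ltL L u z) ∨ (ltL L z u ∧ ltL L u y ∧ ltL L y x)

namespace DGr

/-- `L` is a list of all `X`-vertices of `G`. -/
def IsListOfX (G : DGr) (X : Bool) (L : List ℕ) : Prop :=
  L.Nodup ∧ ∀ v, v ∈ L ↔ G.XVertex X v

/-- `L` is grounded in `G` (w.r.t. the `X`-vertices): `L : v−u−w` implies `ψ_X(v,u,w)`. -/
def GroundedIn (G : DGr) (X : Bool) (L : List ℕ) : Prop :=
  ∀ v u w, BtwL L v u w → G.psi X v u w

end DGr

/-- Two non-empty lists are compatible: they are of the forms `ΦΞ` and `ΞΨ`, or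
`ΦΞΨ` and `Ξ`, for mutually disjoint lists `Φ`, `Ξ`, `Ψ` with `Ξ` non-empty. -/
def ListCompat (L₁ L₂ : List ℕ) : Prop :=
  ∃ Φ Ξ Ψ : List ℕ, Ξ ≠ [] ∧ Φ.Nodup ∧ Ξ.Nodup ∧ Ψ.Nodup ∧
    Φ.Disjoint Ξ ∧ Φ.Disjoint Ψ ∧ Ξ.Disjoint Ψ ∧
    ((L₁ = Φ ++ Ξ ∧ L₂ = Ξ ++ Ψ) ∨ (L₂ = Φ ++ Ξ ∧ L₁ = Ξ ++ Ψ) ∨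
     (L₁ = Φ ++ Ξ ++ Ψ ∧ L₂ = Ξ) ∨ (L₂ = Φ ++ Ξ ++ Ψ ∧ L₁ = Ξ))

namespace DGr

/-- The conditions under which the juncture `G₁ □ G₂` is defined. -/
def JuncDefined (G₁ G₂ : DGr) : Prop :=
  G₁.IsDGraph ∧ G₂.IsDGraph ∧
  (G₁.A ∩ G₂.A).Nonempty ∧
  (∀ a ∈ G₁.A ∩ G₂.A, G₁.E a = G₂.W a ∧ G₁.XEdge false a ∧ G₂.XEdge true a) ∧
  G₁.V ∩ G₂.V = (G₁.A ∩ G₂.A).image G₁.E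

/-- The juncture `G₁ □ G₂` of two graphs. -/
def junc (G₁ G₂ : DGr) : DGr where
  A := G₁.A ∪ G₂.A
  V := (G₁.V ∪ G₂.V) \ (G₁.A ∩ G₂.A).image G₁.E
  W := fun a => if a ∈ G₁.A then G₁.W a else if a ∈ G₂.A then G₂.W a else 0
  E := fun a => if a ∈ G₂.A then G₂.E a else if a ∈ G₁.A then G₁.E a else 0

/-- `G₁` and `G₂` are P-compatible: the juncture is defined, and some list of all
E-vertices of `G₁` grounded in `G₁` and some list of all W-vertices of `G₂`
grounded in `G₂` are compatible. -/
def PCompat (G₁ G₂ : DGr) : Prop :=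
  G₁.JuncDefined G₂ ∧
  ∃ Λ₁ Λ₂ : List ℕ,
    G₁.IsListOfX false Λ₁ ∧ G₁.GroundedIn false Λ₁ ∧
    G₂.IsListOfX true Λ₂ ∧ G₂.GroundedIn true Λ₂ ∧
    ListCompat Λ₁ Λ₂

end DGr

/-- Constructions of P′-graphs: `Construction D L_W L_E` says that there is a
construction whose root carries the triple `(D, L_W, L_E)`. -/
inductive Construction : DGr → List ℕ → List ℕ → Prop
  | basic (G : DGr) (LW LE : List ℕ) :
      G.IsBasicDGraph → G.IsListOfX true LW → G.IsListOfX false LE →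
      Construction G LW LE
  | box (GW GE : DGr) (LWW LEE Φe Ξ Ψe Φw Ψw : List ℕ) :
      Construction GW LWW (Φe ++ Ξ ++ Ψe) →
      Construction GE (Φw ++ Ξ ++ Ψw) LEE →
      GW.JuncDefined GE →
      Ξ ≠ [] →
      (Φe = [] ∨ Φw = []) → (Ψe = [] ∨ Ψw = []) →
      Φe.Disjoint Ξ → Φe.Disjoint Ψe → Ξ.Disjoint Ψe →
      Φw.Disjoint Ξ → Φw.Disjoint Ψw → Ξ.Disjoint Ψw →
      Φe.Disjoint Φw → Φe.Disjoint Ψw → Ψe.Disjoint Φw → Ψe.Disjoint Ψw →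
      Construction (GW.junc GE) (Φw ++ LWW ++ Ψw) (Φe ++ LEE ++ Ψe)

/-- A P′-graph is the root graph of a construction. -/
def IsP1Graph (G : DGr) : Prop := ∃ LW LE, Construction G LW LE

/-- P″-graphs: basic D-graphs, closed under juncture of P-compatible pairs. -/
inductive IsP2Graph : DGr → Prop
  | basic (G : DGr) : G.IsBasicDGraph → IsP2Graph G
  | box (GW GE : DGr) : IsP2Graph GW → IsP2Graph GE → GW.PCompat GE →
      IsP2Graph (GW.junc GE)

namespace DGr

/-- `H` is a subgraph of `G`. -/
def IsSubgraph (H G : DGr) : Prop :=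
  H.A ⊆ G.A ∧ H.V ⊆ G.V ∧ ∀ a ∈ H.A, H.W a = G.W a ∧ H.E a = G.E a

/-- `H` is a component of `G`: a maximal weakly connected non-empty subgraph. -/
def IsComponent (H G : DGr) : Prop :=
  H.IsSubgraph G ∧ H.V.Nonempty ∧ H.WeaklyConnected ∧
  ∀ H' : DGr, H'.IsSubgraph G → H'.WeaklyConnected → H.IsSubgraph H' → H'.IsSubgraph H

/-- Canonical graphs: the end functions are `0` outside the edge set.  Each
component of a graph has exactly one canonical representative. -/
def Canonical (H : DGr) : Prop := ∀ a, a ∉ H.A → H.W a = 0 ∧ H.E a = 0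

def IsComponentC (H G : DGr) : Prop := H.IsComponent G ∧ H.Canonical

/-- The graph left after removing the set `S` of edges from `G`. -/
def removeEdges (G : DGr) (S : Finset ℕ) : DGr := ⟨G.A \ S, G.V, G.W, G.E⟩

end DGr

/-- The edge relation of the componential graph `C_S(D)`, on (canonical)
components of the graph obtained by removing `S` from `D`. -/
def compEdge (D : DGr) (S : Finset ℕ) (H₁ H₂ : DGr) : Prop :=
  H₁.IsComponentC (D.removeEdges S) ∧ H₂.IsComponentC (D.removeEdges S) ∧ H₁ ≠ H₂ ∧
  ∃ a ∈ S, D.W a ∈ H₁.V ∧ D.E a ∈ H₂.V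

/-- `S` is a strict cutset of `D`. -/
def IsStrictCutset (D : DGr) (S : Finset ℕ) : Prop :=
  (∀ a ∈ S, D.InnerEdge a) ∧
  2 ≤ {H : DGr | H.IsComponentC (D.removeEdges S)}.ncard ∧
  (∀ a ∈ S, ∃ H₁ H₂ : DGr, H₁.IsComponentC (D.removeEdges S) ∧
     H₂.IsComponentC (D.removeEdges S) ∧ H₁ ≠ H₂ ∧ D.W a ∈ H₁.V ∧ D.E a ∈ H₂.V) ∧
  ∀ H : DGr, ¬ Relation.TransGen (compEdge D S) H H

/-- A cocycle is a strict cutset whose removal leaves exactly two components. -/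
def IsCocycle (D : DGr) (C : Finset ℕ) : Prop :=
  IsStrictCutset D C ∧ {H : DGr | H.IsComponentC (D.removeEdges C)}.ncard = 2

/-- `(DW, DE)` are (up to the choice of fresh vertices) the two D-graphs obtained
by cutting `D` through the cocycle `C`. -/
def IsCutting (D : DGr) (C : Finset ℕ) (DW DE : DGr) : Prop :=
  ∃ (H₁ H₂ : DGr) (f : ℕ → ℕ),
    H₁.IsComponentC (D.removeEdges C) ∧ H₂.IsComponentC (D.removeEdges C) ∧ H₁ ≠ H₂ ∧
    (∀ a ∈ C, D.W a ∈ H₁.V ∧ D.E a ∈ H₂.V) ∧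
    Set.InjOn f ↑C ∧ (∀ a ∈ C, f a ∉ D.V) ∧
    DW = ⟨H₁.A ∪ C, H₁.V ∪ C.image f,
          fun a => if a ∈ C then D.W a else H₁.W a,
          fun a => if a ∈ C then f a else H₁.E a⟩ ∧
    DE = ⟨H₂.A ∪ C, H₂.V ∪ C.image f,
          fun a => if a ∈ C then f a else H₂.W a,
          fun a => if a ∈ C then D.E a else H₂.E a⟩

/-- A P‴-graph: a D-graph such that for every cocycle `C`, the two D-graphs
obtained by cutting through `C` are P-compatible. -/
def IsP3Graph (D : DGr) : Prop :=
  D.IsDGraph ∧ ∀ C DW DE, IsCocycle D C → IsCutting D C DW DE → DW.PCompat DE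
/-! ### Componential extremes of the componential graph -/

/-- The symmetrization of the relation `R` restricted to the vertex set `Vs`. -/
def symRestr (Vs : Set DGr) (R : DGr → DGr → Prop) (x y : DGr) : Prop :=
  x ∈ Vs ∧ y ∈ Vs ∧ (R x y ∨ R y x)

/-- The number of weakly connected components of the directed graph with vertex
set `Vs` and edge relation `R`. -/
noncomputable def wccCount (Vs : Set DGr) (R : DGr → DGr → Prop) : ℕ :=
  {Cc : Set DGr | ∃ v ∈ Vs, Cc = {w | Relation.ReflTransGen (symRestr Vs R) v w}}.ncard

/-- `H` is a cutvertex of the directed graph `(Vs, R)`: its removal increases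
the number of weakly connected components. -/
def IsCutvertexD (Vs : Set DGr) (R : DGr → DGr → Prop) (H : DGr) : Prop :=
  wccCount Vs R < wccCount (Vs \ {H}) R

/-- `H` is a componential extreme of `C_S(D)`: an outer vertex of the
componential graph (not having both an incoming and an outgoing edge) that is
not a cutvertex. -/
def CompExtreme (D : DGr) (S : Finset ℕ) (H : DGr) : Prop :=
  H.IsComponentC (D.removeEdges S) ∧
  ¬ ((∃ H', compEdge D S H' H) ∧ (∃ H'', compEdge D S H H'')) ∧
  ¬ IsCutvertexD {H' : DGr | H'.IsComponentC (D.removeEdges S)} (compEdge D S) H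

section HelperPart
open Relation

/-- Adjacency in `G` inside the vertex set `V`. -/
def cAdj (A : Finset ℕ) (W E : ℕ → ℕ) (V : Finset ℕ) (u v : ℕ) : Prop :=
  u ∈ V ∧ v ∈ V ∧ ∃ a ∈ A, (W a = u ∧ E a = v) ∨ (W a = v ∧ E a = u)

lemma cAdj_symm {A W E V u v} (h : cAdj A W E V u v) : cAdj A W E V v u := by
  obtain ⟨h1, h2, a, ha, h3⟩ := h
  exact ⟨h2, h1, a, ha, h3.symm⟩

lemma rtg_symm {α : Type*} {r : α → α → Prop} (hs : ∀ x y, r x y → r y x) {x y : α}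
    (h : ReflTransGen r x y) : ReflTransGen r y x := by
  induction h with
  | refl => exact .refl
  | tail _ hbc ih => exact .head (hs _ _ hbc) ih

lemma semiwalk_tail {G : DGr} {u w : ℕ} {vs es : List ℕ} {a : ℕ}
    (h : G.IsSemiwalk (u :: w :: vs) (a :: es)) : G.IsSemiwalk (w :: vs) es := by
  obtain ⟨h1, h2, h3, h4⟩ := h
  refine ⟨by simpa using h1, fun v hv => h2 v (List.mem_cons_of_mem _ hv),
    fun v hv => h3 v (List.mem_cons_of_mem _ hv), ?_⟩
  intro i b x y hb hx hy
  exact h4 (i+1) b x y (by simpa using hb) (by simpa using hx) (by simpa using hy)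

lemma rtg_of_semiwalk {G : DGr} : ∀ (es vs : List ℕ) (u v : ℕ), G.IsSemiwalk vs es →
    vs.head? = some u → vs.getLast? = some v → ReflTransGen (cAdj G.A G.W G.E G.V) u v := by
  intro es
  induction es with
  | nil =>
    intro vs u v h hu hv
    obtain ⟨h1, -⟩ := h
    match vs, h1 with
    | [x], _ => 
      simp at hu hv
      subst hu; subst hv; exact .refl
  | cons a es ih =>
    intro vs u v h hu hv
    match vs, h with
    | [], h => simp at hu
    | [x], h => have := h.1; simp at this
    | x :: y :: vs, h =>
      simp at hu
      subst hu
      refine .head ?_ (ih (y :: vs) y v (semiwalk_tail h) rfl (by simpa using hv))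
      exact ⟨h.2.1 _ (by simp), h.2.1 _ (by simp), a, h.2.2.1 _ (by simp),
        h.2.2.2 0 a x y (by simp) (by simp) (by simp)⟩

lemma semiwalk_cons {G : DGr} {u w a : ℕ} {vs es : List ℕ}
    (h : G.IsSemiwalk (w :: vs) es) (hu : u ∈ G.V) (ha : a ∈ G.A)
    (hs : (G.W a = u ∧ G.E a = w) ∨ (G.W a = w ∧ G.E a = u)) :
    G.IsSemiwalk (u :: w :: vs) (a :: es) := by
  obtain ⟨h1, h2, h3, h4⟩ := h
  refine ⟨by simpa using h1, ?_, ?_, ?_⟩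
  · intro v hv
    rcases List.mem_cons.1 hv with rfl | hv
    · exact hu
    · exact h2 v hv
  · intro v hv
    rcases List.mem_cons.1 hv with rfl | hv
    · exact ha
    · exact h3 v hv
  · intro i b x y hb hx hy
    cases i with
    | zero =>
      simp at hb hx hy
      subst hb; subst hx; subst hy; exact hs
    | succ i => exact h4 i b x y (by simpa using hb) (by simpa using hx) (by simpa using hy)

lemma semipath_sub {G : DGr} {u v : ℕ} : ∀ (es vs : List ℕ), G.IsSemipath vs es →
    vs.getLast? = some v → u ∈ vs → ∃ vs' es', G.SemipathFT u v vs' es' := by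
  intro es
  induction es with
  | nil =>
    intro vs h hl hm
    have h1 := h.1.1
    match vs, h1 with
    | [x], _ =>
      simp at hm
      subst hm
      exact ⟨_, _, h, rfl, hl⟩
  | cons a es ih =>
    intro vs h hl hm
    match vs, h with
    | [], h => simp at hm
    | [x], h => have := h.1.1; simp at this
    | x :: y :: vs, h =>
      by_cases hx : u = x
      · subst hx; exact ⟨_, _, h, rfl, hl⟩
      · exact ih (y :: vs) ⟨semiwalk_tail h.1, (List.nodup_cons.1 h.2).2⟩ (by simpa using hl)
          (by simpa [hx] using hm)

lemma semipath_of_rtg {G : DGr} {u v : ℕ} (hv : v ∈ G.V)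
    (h : ReflTransGen (cAdj G.A G.W G.E G.V) u v) : ∃ vs es, G.SemipathFT u v vs es := by
  induction h using ReflTransGen.head_induction_on with
  | refl =>
    refine ⟨[v], [], ⟨⟨rfl, by simpa using hv, by simp, by simp⟩, by simp⟩, rfl, rfl⟩
  | head hac hrest ih =>
    rename_i x y
    obtain ⟨vs, es, hp, hh, hl⟩ := ih
    by_cases hx : x ∈ vs
    · exact semipath_sub es vs hp hl hx
    · obtain ⟨hx', -, a, ha, hs⟩ := hac
      match vs, hh with
      | z :: vs, hh =>
        simp at hh
        subst hh
        exact ⟨x :: z :: vs, a :: es, ⟨semiwalk_cons hp.1 hx' ha hs, List.nodup_cons.2 ⟨hx, hp.2⟩⟩,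
          rfl, by simpa using hl⟩

lemma wc_iff (G : DGr) : G.WeaklyConnected ↔
    ∀ u ∈ G.V, ∀ v ∈ G.V, ReflTransGen (cAdj G.A G.W G.E G.V) u v := by
  constructor
  · intro h u hu v hv
    by_cases huv : u = v
    · subst huv; exact .refl
    · obtain ⟨vs, es, hp, h1, h2⟩ := h u hu v hv huv
      exact rtg_of_semiwalk es vs u v hp.1 h1 h2
  · intro h u hu v hv _
    exact semipath_of_rtg hv (h u hu v hv)

lemma comp_max {G H : DGr} (hH : H.IsComponent G) (V' : Finset ℕ) (h1 : H.V ⊆ V')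
    (h2 : V' ⊆ G.V) (hc : ∀ u ∈ V', ∀ v ∈ V', ReflTransGen (cAdj G.A G.W G.E V') u v) :
    V' ⊆ H.V ∧ G.A ⊆ H.A := by
  have := hH.2.2.2 ⟨G.A, V', G.W, G.E⟩ ⟨subset_rfl, h2, fun a _ => ⟨rfl, rfl⟩⟩
    ((wc_iff _).2 hc) ⟨hH.1.1, h1, hH.1.2.2⟩
  exact ⟨this.2.1, this.1⟩

lemma comp_conn {G H : DGr} (hH : H.IsComponent G) {V' : Finset ℕ} (hV : H.V ⊆ V') :
    ∀ u ∈ H.V, ∀ v ∈ H.V, ReflTransGen (cAdj G.A G.W G.E V') u v := by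
  intro u hu v hv
  refine ReflTransGen.mono ?_ _ _ ((wc_iff _).1 hH.2.2.1 u hu v hv)
  rintro x y ⟨hx, hy, a, ha, hs⟩
  have := hH.1.2.2 a ha
  rw [this.1, this.2] at hs
  exact ⟨hV hx, hV hy, a, hH.1.1 ha, hs⟩

lemma comp_A {G H : DGr} (hH : H.IsComponent G) : H.A = G.A :=
  subset_antisymm hH.1.1 (comp_max hH H.V subset_rfl hH.1.2.1 (comp_conn hH subset_rfl)).2

lemma comp_sub {G H K : DGr} (hH : H.IsComponent G) (hK : K.IsComponent G) {z : ℕ}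
    (h1 : z ∈ H.V) (h2 : z ∈ K.V) : K.V ⊆ H.V := by
  refine subset_trans Finset.subset_union_right
    (comp_max hH (H.V ∪ K.V) Finset.subset_union_left
      (Finset.union_subset hH.1.2.1 hK.1.2.1) ?_).1
  have key : ∀ u ∈ H.V ∪ K.V, ReflTransGen (cAdj G.A G.W G.E (H.V ∪ K.V)) u z := by
    intro u hu
    rcases Finset.mem_union.1 hu with hu | hu
    · exact comp_conn hH Finset.subset_union_left u hu z h1
    · exact comp_conn hK Finset.subset_union_right u hu z h2
  intro u hu v hv
  exact (key u hu).trans (rtg_symm (fun _ _ => cAdj_symm) (key v hv))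

lemma comp_unique {G H K : DGr} (hH : H.IsComponentC G) (hK : K.IsComponentC G) {z : ℕ}
    (h1 : z ∈ H.V) (h2 : z ∈ K.V) : H = K := by
  have hV : H.V = K.V := subset_antisymm (comp_sub hK.1 hH.1 h2 h1) (comp_sub hH.1 hK.1 h1 h2)
  have hA : H.A = K.A := (comp_A hH.1).trans (comp_A hK.1).symm
  have hWE : ∀ a, H.W a = K.W a ∧ H.E a = K.E a := by
    intro a
    by_cases ha : a ∈ H.A
    · have e1 := hH.1.1.2.2 a ha
      have e2 := hK.1.1.2.2 a (hA ▸ ha)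
      exact ⟨e1.1.trans e2.1.symm, e1.2.trans e2.2.symm⟩
    · have e1 := hH.2 a ha
      have e2 := hK.2 a (hA ▸ ha)
      exact ⟨e1.1.trans e2.1.symm, e1.2.trans e2.2.symm⟩
  have hW : H.W = K.W := funext fun a => (hWE a).1
  have hE : H.E = K.E := funext fun a => (hWE a).2
  cases H; cases K
  simp only at hV hA hW hE
  subst hV hA hW hE
  rfl

lemma comp_ext {G H : DGr} (hH : H.IsComponent G) {z z' : ℕ} (hz : z ∈ H.V) (hz' : z' ∈ G.V)
    {a : ℕ} (ha : a ∈ G.A) (hs : (G.W a = z ∧ G.E a = z') ∨ (G.W a = z' ∧ G.E a = z)) :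
    z' ∈ H.V := by
  refine (comp_max hH (insert z' H.V) (Finset.subset_insert _ _)
      (Finset.insert_subset hz' hH.1.2.1) ?_).1 (Finset.mem_insert_self _ _)
  have key : ∀ u ∈ insert z' H.V, ReflTransGen (cAdj G.A G.W G.E (insert z' H.V)) u z := by
    intro u hu
    rcases Finset.mem_insert.1 hu with rfl | hu
    · exact .single ⟨Finset.mem_insert_self _ _, Finset.mem_insert_of_mem hz, a, ha, hs.symm⟩
    · exact comp_conn hH (Finset.subset_insert _ _) u hu z hz
  intro u hu v hv
  exact (key u hu).trans (rtg_symm (fun _ _ => cAdj_symm) (key v hv))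

lemma symRestr_symm {Vs : Set DGr} {R : DGr → DGr → Prop} (x y : DGr)
    (h : symRestr Vs R x y) : symRestr Vs R y x := ⟨h.2.1, h.1, h.2.2.symm⟩

lemma compGraph_conn (D : DGr) (hD : D.IsDGraph) (S : Finset ℕ) (hS : IsStrictCutset D S)
    (H K : DGr) (hH : H.IsComponentC (D.removeEdges S)) (hK : K.IsComponentC (D.removeEdges S)) :
    ReflTransGen (symRestr {H' : DGr | H'.IsComponentC (D.removeEdges S)} (compEdge D S)) H K := by
  obtain ⟨u, hu⟩ := hH.1.2.1
  obtain ⟨v, hv⟩ := hK.1.2.1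
  have huv := (wc_iff D).1 hD.2.2.2.1 u (hH.1.1.2.1 hu) v (hK.1.1.2.1 hv)
  have : ∃ L : DGr, L.IsComponentC (D.removeEdges S) ∧ v ∈ L.V ∧
      ReflTransGen (symRestr {H' : DGr | H'.IsComponentC (D.removeEdges S)} (compEdge D S)) H L := by
    clear hv hK
    induction huv with
    | refl => exact ⟨H, hH, hu, .refl⟩
    | tail _ hbc ih =>
      rename_i b c
      obtain ⟨L, hL, hb, hr⟩ := ih
      obtain ⟨hbV, hcV, a, ha, hs⟩ := hbc
      by_cases haS : a ∈ S
      · obtain ⟨H₁, H₂, h1, h2, hne, hW, hE⟩ := hS.2.2.1 a haS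
        have hce : compEdge D S H₁ H₂ := ⟨h1, h2, hne, a, haS, hW, hE⟩
        rcases hs with ⟨e1, e2⟩ | ⟨e1, e2⟩
        · have : L = H₁ := comp_unique hL h1 hb (e1 ▸ hW)
          subst this
          exact ⟨H₂, h2, e2 ▸ hE, hr.tail ⟨h1, h2, .inl hce⟩⟩
        · have : L = H₂ := comp_unique hL h2 hb (e2 ▸ hE)
          subst this
          exact ⟨H₁, h1, e1 ▸ hW, hr.tail ⟨h2, h1, .inr hce⟩⟩
      · exact ⟨L, hL, comp_ext (a := a) hL.1 hb hcV (Finset.mem_sdiff.2 ⟨ha, haS⟩) hs, hr⟩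
  obtain ⟨L, hL, hvL, hr⟩ := this
  rwa [comp_unique hL hK hvL hv] at hr

lemma last_before {Vs : Set DGr} {R : DGr → DGr → Prop} {a c : DGr} (hac : a ≠ c)
    (h : ReflTransGen (symRestr Vs R) a c) :
    ∃ k, ReflTransGen (symRestr (Vs \ {c}) R) a k ∧ symRestr Vs R k c := by
  induction h using ReflTransGen.head_induction_on with
  | refl => exact absurd rfl hac
  | head hxy hrest ih =>
    rename_i x y
    by_cases hy : y = c
    · subst hy; exact ⟨x, .refl, hxy⟩
    · obtain ⟨k, h1, h2⟩ := ih hy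
      exact ⟨k, .head ⟨⟨hxy.1, hac⟩, ⟨hxy.2.1, hy⟩, hxy.2.2⟩ h1, h2⟩

lemma cut_disconn {Vs : Set DGr} {R : DGr → DGr → Prop} (hfin : Vs.Finite) {x : DGr}
    (hx : x ∈ Vs) (hcut : IsCutvertexD Vs R x) :
    ∃ u ∈ Vs \ {x}, ∃ w ∈ Vs \ {x}, ¬ ReflTransGen (symRestr (Vs \ {x}) R) u w := by
  by_contra! hcon
  have h1 : 1 ≤ wccCount Vs R := by
    unfold wccCount
    have hf : {Cc : Set DGr | ∃ v ∈ Vs,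
        Cc = {w | ReflTransGen (symRestr Vs R) v w}}.Finite := by
      have := hfin.image (fun v => {w | ReflTransGen (symRestr Vs R) v w})
      refine this.subset ?_
      rintro _ ⟨v, hv, rfl⟩
      exact ⟨v, hv, rfl⟩
    exact (Set.ncard_pos hf).2 ⟨_, x, hx, rfl⟩
  have h2 : wccCount (Vs \ {x}) R ≤ 1 := by
    unfold wccCount
    have hss : {Cc : Set DGr | ∃ v ∈ Vs \ {x},
        Cc = {w | ReflTransGen (symRestr (Vs \ {x}) R) v w}}.Subsingleton := by
      rintro _ ⟨v, hv, rfl⟩ _ ⟨w, hw, rfl⟩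
      ext z
      exact ⟨fun h => (hcon w hw v hv).trans h, fun h => (hcon v hv w hw).trans h⟩
    rcases hss.eq_empty_or_singleton with h | ⟨a, h⟩
    · rw [h]; simp
    · rw [h]; simp
  unfold IsCutvertexD at hcut
  omega

lemma exists_sink {Vs : Set DGr} {R : DGr → DGr → Prop} (hfin : Vs.Finite)
    (hR : ∀ x y, R x y → x ∈ Vs ∧ y ∈ Vs) (hac : ∀ x, ¬ TransGen R x x) (k : DGr) (hk : k ∈ Vs) :
    ∃ x, ReflTransGen R k x ∧ ∀ y, ¬ R x y := by
  have hsub : {x | ReflTransGen R k x} ⊆ Vs := by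
    intro x hx
    rcases ReflTransGen.cases_tail hx with rfl | ⟨y, _, h⟩
    · exact hk
    · exact (hR _ _ h).2
  induction hn : {x | ReflTransGen R k x}.ncard using Nat.strong_induction_on generalizing k with
  | _ n ih =>
    by_cases h : ∀ y, ¬ R k y
    · exact ⟨k, .refl, h⟩
    · push Not at h
      obtain ⟨y, hy⟩ := h
      have hss : {x | ReflTransGen R y x} ⊂ {x | ReflTransGen R k x} := by
        refine ⟨fun x hx => ReflTransGen.head hy hx, fun hh => ?_⟩
        exact hac k (TransGen.head' hy (hh (ReflTransGen.refl : ReflTransGen R k k)))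
      obtain ⟨x, h1, h2⟩ := ih _ (hn ▸ Set.ncard_lt_ncard hss (hfin.subset hsub)) y (hR _ _ hy).2
        (hss.1.trans hsub) rfl
      exact ⟨x, .head hy h1, h2⟩

/-- From a neighbour `k` of `c` with `c → k`, there is a sink in the component of `k` in `Vs \ {c}`. -/
lemma sink_in {Vs : Set DGr} {R : DGr → DGr → Prop} (hfin : Vs.Finite)
    (hR : ∀ x y, R x y → x ∈ Vs ∧ y ∈ Vs) (hac : ∀ x, ¬ TransGen R x x) {c k : DGr}
    (hck : R c k) :
    ∃ x ∈ Vs \ {c}, ReflTransGen (symRestr (Vs \ {c}) R) k x ∧ ∀ y, ¬ R x y := by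
  obtain ⟨x, h1, h2⟩ := exists_sink hfin hR hac k (hR _ _ hck).2
  have key : ∀ z, ReflTransGen R k z →
      z ∈ Vs \ {c} ∧ ReflTransGen (symRestr (Vs \ {c}) R) k z := by
    intro z hz
    have hne : ∀ z, ReflTransGen R k z → z ≠ c := by
      rintro z hz rfl
      exact hac z (TransGen.head' hck hz)
    induction hz with
    | refl => exact ⟨⟨(hR _ _ hck).2, hne _ .refl⟩, .refl⟩
    | tail hkb hbc ih =>
      have hm := hne _ (hkb.tail hbc)
      exact ⟨⟨(hR _ _ hbc).2, hm⟩, ih.2.tail ⟨ih.1, ⟨(hR _ _ hbc).2, hm⟩, .inl hbc⟩⟩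
  exact ⟨x, (key x h1).1, (key x h1).2, h2⟩

lemma symRestr_swap (Vs : Set DGr) (R : DGr → DGr → Prop) :
    symRestr Vs (Function.swap R) = symRestr Vs R := by
  funext x y
  simp only [symRestr, Function.swap, or_comm]

lemma exists_extreme {Vs : Set DGr} {R : DGr → DGr → Prop} (hfin : Vs.Finite)
    (hR : ∀ x y, R x y → x ∈ Vs ∧ y ∈ Vs) (hac : ∀ x, ¬ TransGen R x x)
    (hconn : ∀ x ∈ Vs, ∀ y ∈ Vs, ReflTransGen (symRestr Vs R) x y) :
    ∀ (n : ℕ) (c k : DGr), c ∈ Vs → k ∈ Vs \ {c} →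
      {w | ReflTransGen (symRestr (Vs \ {c}) R) k w}.ncard = n →
      ∃ x ∈ Vs \ {c}, ReflTransGen (symRestr (Vs \ {c}) R) k x ∧
        ¬ ((∃ y, R y x) ∧ (∃ y, R x y)) ∧ ¬ IsCutvertexD Vs R x := by
  have hsub : ∀ c k : DGr, k ∈ Vs \ {c} →
      {w | ReflTransGen (symRestr (Vs \ {c}) R) k w} ⊆ Vs \ {c} := by
    intro c k hk w hw
    rcases ReflTransGen.cases_tail hw with rfl | ⟨y, _, h⟩
    · exact hk
    · exact h.2.1
  intro n
  induction n using Nat.strong_induction_on with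
  | _ n ih =>
    intro c k0 hc hk0 hn
    obtain ⟨k, hk0k, hkc⟩ := last_before hk0.2 (hconn k0 hk0.1 c hc)
    obtain ⟨x, hx, hkx, hout⟩ : ∃ x ∈ Vs \ {c}, ReflTransGen (symRestr (Vs \ {c}) R) k x ∧
        ¬ ((∃ y, R y x) ∧ (∃ y, R x y)) := by
      rcases hkc.2.2 with h | h
      · obtain ⟨x, h1, h2, h3⟩ := sink_in (R := Function.swap R) hfin
          (fun x y h => (hR _ _ h).symm) (fun x h => hac x (transGen_swap.1 h)) h
        rw [symRestr_swap] at h2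
        exact ⟨x, h1, h2, fun ⟨⟨y, hy⟩, _⟩ => h3 y hy⟩
      · obtain ⟨x, h1, h2, h3⟩ := sink_in hfin hR hac h
        exact ⟨x, h1, h2, fun ⟨_, ⟨y, hy⟩⟩ => h3 y hy⟩
    by_cases hcut : IsCutvertexD Vs R x
    swap
    · exact ⟨x, hx, hk0k.trans hkx, hout, hcut⟩
    obtain ⟨u, hu, huc⟩ : ∃ u ∈ Vs \ {x}, ¬ ReflTransGen (symRestr (Vs \ {x}) R) u c := by
      by_contra! hcon
      obtain ⟨u, hu, w, hw, hn⟩ := cut_disconn hfin hx.1 hcut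
      exact hn ((hcon u hu).trans (rtg_symm symRestr_symm (hcon w hw)))
    have hmove : ∀ w, ReflTransGen (symRestr (Vs \ {x}) R) u w →
        ReflTransGen (symRestr (Vs \ {c}) R) u w := by
      intro w hw
      induction hw with
      | refl => exact .refl
      | tail hub hbd ihw =>
        refine ihw.tail ⟨⟨hbd.1.1, ?_⟩, ⟨hbd.2.1.1, ?_⟩, hbd.2.2⟩
        · rintro rfl; exact huc hub
        · rintro rfl; exact huc (hub.tail hbd)
    obtain ⟨y, huy, hyx⟩ := last_before hu.2 (hconn u hu.1 x hx.1)
    have hyc : y ≠ c := by rintro rfl; exact huc huy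
    have hxu : ReflTransGen (symRestr (Vs \ {c}) R) x u :=
      rtg_symm symRestr_symm ((hmove y huy).tail ⟨⟨hyx.1, hyc⟩, hx, hyx.2.2⟩)
    have hk0x := hk0k.trans hkx
    have hss : {w | ReflTransGen (symRestr (Vs \ {x}) R) u w} ⊂
        {w | ReflTransGen (symRestr (Vs \ {c}) R) k0 w} := by
      refine ⟨fun w hw => (hk0x.trans hxu).trans (hmove w hw), fun hh => ?_⟩
      exact (hsub x u hu (hh hk0x)).2 rfl
    have hlt := Set.ncard_lt_ncard hss (hfin.subset ((hsub c k0 hk0).trans Set.sdiff_subset))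
    obtain ⟨z, hz, h1, h2, h3⟩ := ih _ (hn ▸ hlt) x u hx.1 hu rfl
    exact ⟨z, hsub c k0 hk0 (hss.1 h1), hss.1 h1, h2, h3⟩

end HelperPart

/-- **Proposition 1.6.2**: if `S` is a strict cutset of the D-graph `D`, then
there are at least two componential extremes in `C_S(D)`. -/
theorem two_componential_extremes (D : DGr) (hD : D.IsDGraph)
    (S : Finset ℕ) (hS : IsStrictCutset D S) :
    ∃ H₁ H₂ : DGr, H₁ ≠ H₂ ∧ CompExtreme D S H₁ ∧ CompExtreme D S H₂ := by
  have hcard := hS.2.1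
  have hfin : {H : DGr | H.IsComponentC (D.removeEdges S)}.Finite := by
    apply Set.finite_of_ncard_ne_zero
    omega
  have hR : ∀ x y, compEdge D S x y → x ∈ {H : DGr | H.IsComponentC (D.removeEdges S)} ∧
      y ∈ {H : DGr | H.IsComponentC (D.removeEdges S)} := fun x y h => ⟨h.1, h.2.1⟩
  have hmain := exists_extreme hfin hR hS.2.2.2
    (fun x hx y hy => compGraph_conn D hD S hS x y hx hy)
  obtain ⟨p, q, hp, hq, hpq⟩ := (Set.one_lt_ncard_iff hfin).1 hcard
  obtain ⟨x, hx, -, hx1, hx2⟩ := hmain _ p q hp ⟨hq, fun h => hpq h.symm⟩ rfl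
  obtain ⟨y, hy, -, hy1, hy2⟩ := hmain _ x p hx.1 ⟨hp, fun h => hx.2 h.symm⟩ rfl
  exact ⟨x, y, fun h => hy.2 h.symm, ⟨hx.1, hx1, hx2⟩, ⟨hy.1, hy1, hy2⟩⟩
end

section
/- Let K be a construction with root triple (D, L_W, L_E). Then: (1) if x <_{L_W} y and z <_{L_E} u, then every semipath in [x,u] and every semipath in [y,z] intersect; (2) if L_X : x−y−z, then ψ_X(x,y,z); in particular L_W and L_E are grounded in D; (3) if L_X : x−y−u−z, then every semipath in [x,u] and every semipath in [y,z] intersect. -/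
namespace PfG

abbrev F2 := ZMod 2

/-- mod 2 boundary of an edge chain -/
def bd (G : DGr) (f : ℕ → F2) (v : ℕ) : F2 :=
  ∑ a ∈ G.A, f a * ((if G.W a = v then 1 else 0) + (if G.E a = v then 1 else 0))

def sm (l : List ℕ) (s : ℕ → F2) : F2 := (l.map s).sum

def pr : List ℕ → (ℕ → F2) → (ℕ → F2) → F2
  | [], _, _ => 0
  | a :: l, s, t => s a * sm l t + pr l s t

def dl (x v : ℕ) : F2 := if v = x then 1 else 0

@[simp] lemma sm_nil (s) : sm [] s = 0 := rfl
@[simp] lemma sm_cons (a l s) : sm (a :: l) s = s a + sm l s := by simp [sm]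
@[simp] lemma sm_append (l m s) : sm (l ++ m) s = sm l s + sm m s := by simp [sm]
@[simp] lemma sm_reverse (l s) : sm l.reverse s = sm l s := by
  induction l with
  | nil => rfl
  | cons a l ih => simp [ih, add_comm]
@[simp] lemma pr_nil (s t) : pr [] s t = 0 := rfl
@[simp] lemma pr_cons (a l s t) : pr (a :: l) s t = s a * sm l t + pr l s t := rfl
lemma pr_append (l m s t) : pr (l ++ m) s t = pr l s t + pr m s t + sm l s * sm m t := by
  induction l with
  | nil => simp
  | cons a l ih => simp [ih]; ring
lemma pr_reverse (l s t) : pr l.reverse s t = pr l t s := by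
  induction l with
  | nil => rfl
  | cons a l ih => simp [pr_append, ih]; ring
lemma sm_congr {l : List ℕ} {s s' : ℕ → F2} (h : ∀ v ∈ l, s v = s' v) : sm l s = sm l s' := by
  unfold sm; rw [List.map_congr_left h]
lemma pr_congr {l : List ℕ} {s s' t t' : ℕ → F2} (h : ∀ v ∈ l, s v = s' v)
    (h' : ∀ v ∈ l, t v = t' v) : pr l s t = pr l s' t' := by
  induction l with
  | nil => rfl
  | cons a l ih =>
    simp only [List.mem_cons, forall_eq_or_imp] at h h'
    simp [h.1, sm_congr h'.2, ih h.2 h'.2]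
lemma pr_swap {l : List ℕ} {s t : ℕ → F2} (h : ∀ v ∈ l, s v * t v = 0) :
    pr l s t + pr l t s = sm l s * sm l t := by
  induction l with
  | nil => simp
  | cons a l ih =>
    simp only [List.mem_cons, forall_eq_or_imp] at h
    have := ih h.2
    simp only [pr_cons, sm_cons]
    linear_combination this - h.1

lemma ltL_cons (c l x y) : ltL (c :: l) x y ↔ (x = c ∧ y ∈ l) ∨ ltL l x y := by
  unfold ltL
  constructor
  · rintro ⟨i, j, hij, hi, hj⟩
    obtain ⟨j, rfl⟩ : ∃ k, j = k + 1 := ⟨j - 1, by omega⟩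
    cases i with
    | zero =>
      left
      simp at hi hj
      exact ⟨hi.symm, List.mem_of_getElem? hj⟩
    | succ i =>
      right
      simp at hi hj
      exact ⟨i, j, by omega, hi, hj⟩
  · rintro (⟨rfl, h⟩ | ⟨i, j, hij, hi, hj⟩)
    · obtain ⟨j, hj⟩ := List.mem_iff_getElem?.1 h
      exact ⟨0, j + 1, by omega, by simp, by simpa using hj⟩
    · exact ⟨i + 1, j + 1, by omega, by simpa using hi, by simpa using hj⟩

lemma ltL_nil (x y) : ¬ ltL [] x y := by
  rintro ⟨i, j, hij, hi, hj⟩; simp at hi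

lemma ltL_mem {l x y} (h : ltL l x y) : x ∈ l ∧ y ∈ l := by
  obtain ⟨i, j, hij, hi, hj⟩ := h
  exact ⟨List.mem_of_getElem? hi, List.mem_of_getElem? hj⟩

lemma ltL_append (l m x y) : ltL (l ++ m) x y ↔ ltL l x y ∨ ltL m x y ∨ (x ∈ l ∧ y ∈ m) := by
  induction l with
  | nil => simp [ltL_nil]
  | cons a l ih => simp only [List.cons_append, ltL_cons, ih, List.mem_append, List.mem_cons]; tauto

lemma ltL_reverse (l x y) : ltL l.reverse x y ↔ ltL l y x := by
  induction l with
  | nil => simp [ltL_nil]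
  | cons a l ih => simp [ltL_append, ltL_cons, ltL_nil, ih]; tauto

lemma ltL_asymm {l x y} (hl : l.Nodup) (h : ltL l x y) (h' : ltL l y x) : False := by
  induction l with
  | nil => exact ltL_nil _ _ h
  | cons a l ih =>
    rw [List.nodup_cons] at hl
    rw [ltL_cons] at h h'
    rcases h with ⟨rfl, h⟩ | h <;> rcases h' with ⟨rfl, h'⟩ | h'
    · exact hl.1 h
    · exact hl.1 (ltL_mem h').2
    · exact hl.1 (ltL_mem h).2
    · exact ih hl.2 h h'

lemma ltL_trans {l x y z} (hl : l.Nodup) (h : ltL l x y) (h' : ltL l y z) : ltL l x z := by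
  induction l with
  | nil => exact (ltL_nil _ _ h).elim
  | cons a l ih =>
    rw [List.nodup_cons] at hl
    rw [ltL_cons] at h h' ⊢
    rcases h with ⟨rfl, h⟩ | h <;> rcases h' with ⟨rfl, h'⟩ | h'
    · exact (hl.1 h).elim
    · exact Or.inl ⟨rfl, (ltL_mem h').2⟩
    · exact (hl.1 (ltL_mem h).2).elim
    · exact Or.inr (ih hl.2 h h')

lemma sm_dl {l : List ℕ} (hl : l.Nodup) (y) : sm l (dl y) = if y ∈ l then 1 else 0 := by
  induction l with
  | nil => simp
  | cons a l ih =>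
    rw [List.nodup_cons] at hl
    simp only [sm_cons, ih hl.2, dl, List.mem_cons]
    by_cases h : a = y
    · subst h; simp [hl.1]
    · simp [h, Ne.symm h]

open Classical in
lemma pr_dl {l : List ℕ} (hl : l.Nodup) (x y) :
    pr l (dl x) (dl y) = if ltL l x y then 1 else 0 := by
  induction l with
  | nil => simp [ltL_nil]
  | cons a l ih =>
    rw [List.nodup_cons] at hl
    simp only [pr_cons, ih hl.2, sm_dl hl.2, ltL_cons, dl]
    by_cases h : a = x
    · subst h
      have : ¬ ltL l a y := fun h => hl.1 (ltL_mem h).1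
      simp [this]
    · simp [h, Ne.symm h]

lemma sm_add (l s s') : sm l (fun v => s v + s' v) = sm l s + sm l s' := by
  induction l with
  | nil => simp
  | cons a l ih => simp [ih]; ring

lemma pr_add (l s s' t t') : pr l (fun v => s v + s' v) (fun v => t v + t' v) =
    pr l s t + pr l s t' + pr l s' t + pr l s' t' := by
  induction l with
  | nil => simp
  | cons a l ih => simp [ih, sm_add]; ring

lemma pr4 {l : List ℕ} {a b c d} (hl : l.Nodup) (h1 : ltL l a b) (h2 : ltL l b c)
    (h3 : ltL l c d) :
    pr l (fun v => dl a v + dl c v) (fun v => dl b v + dl d v) = 1 := by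
  have h4 := ltL_trans hl h1 (ltL_trans hl h2 h3)
  have h5 : ¬ ltL l c b := fun h => ltL_asymm hl h2 h
  rw [pr_add, pr_dl hl, pr_dl hl, pr_dl hl, pr_dl hl]
  simp only [h1, h3, h4, h5, if_true, if_false]
  decide

def Dj (G : DGr) (f g : ℕ → F2) : Prop :=
  ∀ a ∈ G.A, ∀ b ∈ G.A, f a ≠ 0 → g b ≠ 0 →
    G.W a ≠ G.W b ∧ G.W a ≠ G.E b ∧ G.E a ≠ G.W b ∧ G.E a ≠ G.E b

structure Inv (G : DGr) (LW LE : List ℕ) : Prop where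
  lw : G.IsListOfX true LW
  le : G.IsListOfX false LE
  dis : LW.Disjoint LE
  H : ∀ f g : ℕ → F2, (∀ v, G.InnerVertex v → bd G f v = 0) →
    (∀ v, G.InnerVertex v → bd G g v = 0) → Dj G f g →
    pr (LW ++ LE.reverse) (bd G f) (bd G g) = 0

def Con (G : DGr) (x u : ℕ) (S : List ℕ) : Prop :=
  ∃ f : ℕ → F2, (∀ v, bd G f v = dl x v + dl u v) ∧
    ∀ a ∈ G.A, f a ≠ 0 → G.W a ∈ S ∧ G.E a ∈ S

lemma Con.symm {G x u S} (h : Con G x u S) : Con G u x S := by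
  obtain ⟨f, h1, h2⟩ := h
  exact ⟨f, fun v => by rw [h1, add_comm], h2⟩

lemma bd_add (G f g v) : bd G (fun a => f a + g a) v = bd G f v + bd G g v := by
  unfold bd; rw [← Finset.sum_add_distrib]; exact Finset.sum_congr rfl fun _ _ => by ring

lemma bd_dl (G : DGr) (a v) (ha : a ∈ G.A) :
    bd G (dl a) v = dl (G.W a) v + dl (G.E a) v := by
  unfold bd
  rw [Finset.sum_eq_single a]
  · simp [dl, eq_comm]
  · intro b _ hb; simp [dl, hb]
  · exact fun h => (h ha).elim

lemma con_of (G : DGr) : ∀ (es vs : List ℕ) (x u : ℕ), G.IsSemiwalk vs es →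
    vs.head? = some x → vs.getLast? = some u → Con G x u vs := by
  intro es
  induction es with
  | nil =>
    intro vs x u h hx hu
    obtain ⟨h, -⟩ := h
    obtain ⟨w, rfl⟩ := List.length_eq_one_iff.1 h
    simp at hx hu
    subst hx hu
    refine ⟨fun _ => 0, fun v => ?_, fun _ _ h => (h rfl).elim⟩
    simp only [bd, zero_mul, Finset.sum_const_zero]
    exact (CharTwo.add_self_eq_zero _).symm
  | cons e es ih =>
    intro vs x u h hx hu
    obtain ⟨hl, hv, he, hc⟩ := h
    match vs, hl with
    | x' :: y :: vs, hl =>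
    simp at hx; subst hx
    have hcon := ih (y :: vs) y u ⟨by simpa using hl, fun v h => hv v (by simp_all),
      fun a h => he a (by simp_all), fun i a p q h1 h2 h3 =>
        hc (i+1) a p q (by simpa using h1) (by simpa using h2) (by simpa using h3)⟩ rfl
        (by rw [List.getLast?_cons_cons] at hu; exact hu)
    obtain ⟨f, hf1, hf2⟩ := hcon
    have heA : e ∈ G.A := he e (by simp)
    have hends := hc 0 e x' y rfl rfl rfl
    refine ⟨fun a => dl e a + f a, fun v => ?_, fun a ha hne => ?_⟩
    · rw [bd_add, bd_dl _ _ _ heA, hf1]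
      have h2 : dl y v + dl y v = 0 := CharTwo.add_self_eq_zero _
      rcases hends with ⟨h, h'⟩ | ⟨h, h'⟩ <;> rw [h, h'] <;> linear_combination h2
    · by_cases hae : a = e
      · subst hae
        rcases hends with ⟨h, h'⟩ | ⟨h, h'⟩ <;> simp [h, h']
      · have := hf2 a ha (by simpa [dl, hae] using hne)
        exact ⟨List.mem_cons_of_mem _ this.1, List.mem_cons_of_mem _ this.2⟩

lemma con_sp {G : DGr} {x u vs es} (h : G.SemipathFT x u vs es) : Con G x u vs :=
  con_of G es vs x u h.1.1 h.2.1 h.2.2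

lemma Inv.nd {G LW LE} (h : Inv G LW LE) : (LW ++ LE.reverse).Nodup := by
  rw [List.nodup_append']
  exact ⟨h.lw.1, List.nodup_reverse.2 h.le.1, fun a ha hb => h.dis ha (List.mem_reverse.1 hb)⟩

lemma Inv.notInner {G LW LE} (h : Inv G LW LE) {x} (hx : x ∈ LW ++ LE.reverse) :
    ¬ G.InnerVertex x := by
  intro hi
  rcases List.mem_append.1 hx with hx | hx
  · exact hi.2.1 ((h.lw.2 x).1 hx)
  · exact hi.2.2 ((h.le.2 x).1 (List.mem_reverse.1 hx))

lemma Inv.cross {G LW LE} (h : Inv G LW LE) {a b c d S T}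
    (h1 : ltL (LW ++ LE.reverse) a b) (h2 : ltL (LW ++ LE.reverse) b c)
    (h3 : ltL (LW ++ LE.reverse) c d) (hS : Con G a c S) (hT : Con G b d T) :
    ∃ w, w ∈ S ∧ w ∈ T := by
  by_contra hno
  push Not at hno
  obtain ⟨f, hf, hfS⟩ := hS
  obtain ⟨g, hg, hgT⟩ := hT
  have key : ∀ x y v, x ∈ LW ++ LE.reverse → y ∈ LW ++ LE.reverse → G.InnerVertex v →
      dl x v + dl y v = 0 := by
    intro x y v hx hy hv
    have h1 : v ≠ x := fun e => h.notInner hx (e ▸ hv)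
    have h2 : v ≠ y := fun e => h.notInner hy (e ▸ hv)
    simp [dl, h1, h2]
  have := h.H f g (fun v hv => by rw [hf]; exact key _ _ _ (ltL_mem h1).1 (ltL_mem h3).1 hv)
    (fun v hv => by rw [hg]; exact key _ _ _ (ltL_mem h1).2 (ltL_mem h3).2 hv)
    (fun p hp q hq hfp hgq => by
      have A := hfS p hp hfp
      have B := hgT q hq hgq
      refine ⟨?_, ?_, ?_, ?_⟩ <;> intro e
      · exact hno _ A.1 (e ▸ B.1)
      · exact hno _ A.1 (e ▸ B.2)
      · exact hno _ A.2 (e ▸ B.1)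
      · exact hno _ A.2 (e ▸ B.2))
  rw [funext hf, funext hg, pr4 h.nd h1 h2 h3] at this
  exact one_ne_zero this

lemma bd_agree {G H : DGr} (f) {v : ℕ} (hA : H.A ⊆ G.A)
    (h1 : ∀ a ∈ H.A, (G.W a = v ↔ H.W a = v) ∧ (G.E a = v ↔ H.E a = v))
    (h2 : ∀ a ∈ G.A, a ∉ H.A → G.W a ≠ v ∧ G.E a ≠ v) : bd G f v = bd H f v := by
  unfold bd
  rw [← Finset.sum_subset hA]
  · refine Finset.sum_congr rfl fun a ha => ?_
    simp only [(h1 a ha).1, (h1 a ha).2]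
  · intro a ha hn; simp [h2 a ha hn]

lemma sum_bd {G : DGr} (hG : G.WellFormed) (f) : ∑ v ∈ G.V, bd G f v = 0 := by
  unfold bd
  rw [Finset.sum_comm]
  refine Finset.sum_eq_zero fun a ha => ?_
  rw [← Finset.mul_sum, Finset.sum_add_distrib]
  simp only [Finset.sum_ite_eq, (hG a ha).1, (hG a ha).2, if_true]
  rw [CharTwo.add_self_eq_zero, mul_zero]

lemma sm_list {l : List ℕ} (hl : l.Nodup) (s) : sm l s = ∑ v ∈ l.toFinset, s v := by
  rw [List.sum_toFinset _ hl]; rfl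

lemma total {G LW LE} (h : Inv G LW LE) (hG : G.WellFormed) (f)
    (hf : ∀ v, G.InnerVertex v → bd G f v = 0) : sm LW (bd G f) + sm LE (bd G f) = 0 := by
  rw [sm_list h.lw.1, sm_list h.le.1, ← Finset.sum_union, ← sum_bd hG f]
  · apply Finset.sum_subset
    · intro v hv
      simp only [Finset.mem_union, List.mem_toFinset, h.lw.2, h.le.2] at hv
      rcases hv with hv | hv <;> exact hv.1
    · intro v hv hn
      simp only [Finset.mem_union, List.mem_toFinset, h.lw.2, h.le.2, not_or] at hn
      exact hf v ⟨hv, hn.1, hn.2⟩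
  · rw [Finset.disjoint_left]
    intro a ha hb
    exact h.dis (List.mem_toFinset.1 ha) (List.mem_toFinset.1 hb)

lemma inv_basic {G LW LE} (hG : G.IsBasicDGraph) (hW : G.IsListOfX true LW)
    (hE : G.IsListOfX false LE) : Inv G LW LE := by
  obtain ⟨⟨wf, ac, fn, wc, -⟩, c, hc, huniq⟩ := hG
  refine ⟨hW, hE, ?_, ?_⟩
  · intro v h1 h2
    have h1 := (hW.2 v).1 h1
    have h2 := (hE.2 v).1 h2
    have hne : v ≠ c := fun e => hc.2.1 (e ▸ h1)
    obtain ⟨vs, es, ⟨⟨hl, hv, he, hcc⟩, -⟩, hx, hu⟩ := wc v h1.1 c hc.1 hne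
    match vs, es, hl with
    | [w], [], _ =>
      simp at hx hu; exact hne (hx.symm.trans hu)
    | v' :: y :: vs, e :: es, _ =>
      simp at hx; subst hx
      have heA := he e (by simp)
      have := h1.2 e heA
      have := h2.2 e heA
      simp [DGr.Xf] at *
      rcases hcc 0 e v' y rfl rfl rfl with h | h <;> simp_all
  · intro f g hf hg hd
    -- every edge is incident with c
    have inc : ∀ a ∈ G.A, G.W a = c ∨ G.E a = c := by
      intro a ha
      by_contra hn
      push Not at hn
      have w1 : ¬ G.InnerVertex (G.W a) := fun h => hn.1 (huniq _ h)
      have e1 : ¬ G.InnerVertex (G.E a) := fun h => hn.2 (huniq _ h)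
      have w2 : G.XVertex true (G.W a) := by
        by_contra h
        exact w1 ⟨(wf a ha).1, h, fun h' => h'.2 a ha rfl⟩
      have e2 : G.XVertex false (G.E a) := by
        by_contra h
        exact e1 ⟨(wf a ha).2, fun h' => h'.2 a ha rfl, h⟩
      -- a is an isolated edge component
      have onlyW := fn true a ⟨ha, w2⟩
      have onlyE := fn false a ⟨ha, e2⟩
      simp only [DGr.Xf] at onlyW onlyE
      have clos : ∀ (es vs : List ℕ) (x : ℕ), G.IsSemiwalk vs es → vs.head? = some x →
          vs.getLast? = some c → (x = G.W a ∨ x = G.E a) → False := by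
        intro es
        induction es with
        | nil =>
          intro vs x h hx hu hxa
          obtain ⟨h, -⟩ := h
          obtain ⟨w, rfl⟩ := List.length_eq_one_iff.1 h
          simp at hx hu
          subst hx; subst hu
          rcases hxa with h | h
          · exact hn.1 h.symm
          · exact hn.2 h.symm
        | cons e es ih =>
          intro vs x h hx hu hxa
          obtain ⟨hl, hv, he, hcc⟩ := h
          match vs, hl with
          | x' :: y :: vs, hl =>
          simp at hx; subst hx
          refine ih (y :: vs) y ⟨by simpa using hl, fun v h => hv v (by simp_all),
            fun a h => he a (by simp_all), fun i a p q h1 h2 h3 =>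
            hcc (i+1) a p q (by simpa using h1) (by simpa using h2) (by simpa using h3)⟩ rfl
            (by rw [List.getLast?_cons_cons] at hu; exact hu) ?_
          have heA := he e (by simp)
          have hw2 := w2.2 e heA
          have he2 := e2.2 e heA
          simp only [DGr.Xf, Bool.not_true, Bool.not_false] at hw2 he2
          have hea : e = a := by
            by_contra hne
            have p1 := onlyW e heA hne
            have p2 := onlyE e heA hne
            rcases hcc 0 e x' y rfl rfl rfl with ⟨h, h'⟩ | ⟨h, h'⟩ <;>
              rcases hxa with hh | hh <;> simp_all
          subst hea
          rcases hcc 0 e x' y rfl rfl rfl with ⟨h, h'⟩ | ⟨h, h'⟩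
          · exact Or.inr h'.symm
          · exact Or.inl h.symm
      obtain ⟨vs, es, hp, hx, hu⟩ := wc (G.W a) (wf a ha).1 c hc.1 hn.1
      exact clos es vs _ hp.1 hx hu (Or.inl rfl)
    have : (∀ a ∈ G.A, f a = 0) ∨ (∀ a ∈ G.A, g a = 0) := by
      by_contra hn
      push Not at hn
      obtain ⟨⟨a, ha, hfa⟩, b, hb, hgb⟩ := hn
      obtain ⟨d1, d2, d3, d4⟩ := hd a ha b hb hfa hgb
      rcases inc a ha with h | h <;> rcases inc b hb with h' | h' <;> simp_all
    have z : ∀ l s, pr l (fun _ => 0) s = 0 := by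
      intro l s; induction l <;> simp_all
    have z' : ∀ l, sm l (fun _ => 0) = 0 := by
      intro l; induction l <;> simp_all
    have z2 : ∀ l s, pr l s (fun _ => 0) = 0 := by
      intro l s; induction l <;> simp_all
    rcases this with h | h
    · have : bd G f = fun _ => 0 := by
        funext v; exact Finset.sum_eq_zero fun a ha => by simp [h a ha]
      rw [this, z]
    · have : bd G g = fun _ => 0 := by
        funext v; exact Finset.sum_eq_zero fun a ha => by simp [h a ha]
      rw [this, z2]


lemma f2_cases (x : F2) : x = 0 ∨ x = 1 := by
  revert x; decide

lemma inv_box {G1 G2 : DGr} {LWW LEE Φe Ξ Ψe Φw Ψw : List ℕ}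
    (i1 : Inv G1 LWW (Φe ++ Ξ ++ Ψe)) (i2 : Inv G2 (Φw ++ Ξ ++ Ψw) LEE)
    (hJ : G1.JuncDefined G2)
    (hΦ : Φe = [] ∨ Φw = []) (hΨ : Ψe = [] ∨ Ψw = [])
    (d1 : Φe.Disjoint Ξ) (d2 : Φe.Disjoint Ψe) (d3 : Ξ.Disjoint Ψe)
    (d4 : Φw.Disjoint Ξ) (d5 : Φw.Disjoint Ψw) (d6 : Ξ.Disjoint Ψw)
    (d7 : Φe.Disjoint Φw) (d8 : Φe.Disjoint Ψw) (d9 : Ψe.Disjoint Φw) (d10 : Ψe.Disjoint Ψw) :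
    Inv (G1.junc G2) (Φw ++ LWW ++ Ψw) (Φe ++ LEE ++ Ψe) := by
  obtain ⟨⟨wf1, -, fn1, -, -⟩, ⟨wf2, -, fn2, -, -⟩, -, hC, hV⟩ := hJ
  set J := G1.junc G2 with hJdef
  have JA : ∀ a, a ∈ J.A ↔ a ∈ G1.A ∨ a ∈ G2.A := by intro a; simp [hJdef, DGr.junc]
  have JW1 : ∀ a ∈ G1.A, J.W a = G1.W a := by intro a h; simp [hJdef, DGr.junc, h]
  have JW2 : ∀ a ∈ G2.A, a ∉ G1.A → J.W a = G2.W a := by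
    intro a h h'; simp [hJdef, DGr.junc, h, h']
  have JE2 : ∀ a ∈ G2.A, J.E a = G2.E a := by intro a h; simp [hJdef, DGr.junc, h]
  have JE1 : ∀ a ∈ G1.A, a ∉ G2.A → J.E a = G1.E a := by
    intro a h h'; simp [hJdef, DGr.junc, h, h']
  let isC : ℕ → Prop := fun v => ∃ c, c ∈ G1.A ∧ c ∈ G2.A ∧ G1.E c = v ∧ G2.W c = v
  have memVC : ∀ v, v ∈ (G1.A ∩ G2.A).image G1.E ↔ isC v := by
    intro v
    simp only [Finset.mem_image, Finset.mem_inter, isC]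
    constructor
    · rintro ⟨c, ⟨h1, h2⟩, h3⟩
      exact ⟨c, h1, h2, h3, by rw [← (hC c (Finset.mem_inter.2 ⟨h1, h2⟩)).1, h3]⟩
    · rintro ⟨c, h1, h2, h3, -⟩
      exact ⟨c, ⟨h1, h2⟩, h3⟩
  have JV : ∀ v, v ∈ J.V ↔ (v ∈ G1.V ∨ v ∈ G2.V) ∧ ¬ isC v := by
    intro v; rw [← memVC]; simp only [hJdef, DGr.junc, Finset.mem_sdiff, Finset.mem_union]
  have f1 : ∀ v, v ∈ G1.V → v ∈ G2.V → isC v := by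
    intro v h1 h2; rw [← memVC, ← hV]; exact Finset.mem_inter.2 ⟨h1, h2⟩
  have f2 : ∀ v, isC v → G1.XVertex false v ∧ G2.XVertex true v := by
    rintro v ⟨c, h1, h2, h3, h4⟩
    have := hC c (Finset.mem_inter.2 ⟨h1, h2⟩)
    refine ⟨?_, ?_⟩
    · rw [← h3]; exact this.2.1.2
    · rw [← h4]; exact this.2.2.2
  have memXi : ∀ v, v ∈ Ξ ↔ isC v := by
    intro v
    constructor
    · intro h
      exact f1 v ((i1.le.2 v).1 (by simp [h])).1 ((i2.lw.2 v).1 (by simp [h])).1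
    · intro h
      have a1 := (i1.le.2 v).2 (f2 v h).1
      have a2 := (i2.lw.2 v).2 (f2 v h).2
      simp only [List.mem_append] at a1 a2
      rcases a1 with (a1 | a1) | a1
      · rcases a2 with (a2 | a2) | a2
        · exact (d7 a1 a2).elim
        · exact a2
        · exact (d8 a1 a2).elim
      · exact a1
      · rcases a2 with (a2 | a2) | a2
        · exact (d9 a1 a2).elim
        · exact a2
        · exact (d10 a1 a2).elim
  have loc1 : ∀ v, v ∈ G1.V → ¬ isC v →
      (∀ a ∈ G1.A, (J.W a = v ↔ G1.W a = v) ∧ (J.E a = v ↔ G1.E a = v)) ∧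
      (∀ a ∈ J.A, a ∉ G1.A → J.W a ≠ v ∧ J.E a ≠ v) := by
    intro v hv hn
    have n2 : v ∉ G2.V := fun h => hn (f1 v hv h)
    refine ⟨fun a ha => ⟨by rw [JW1 a ha], ?_⟩, fun a ha hna => ?_⟩
    · by_cases h2 : a ∈ G2.A
      · rw [JE2 a h2]
        constructor
        · intro h; exact (n2 (h ▸ (wf2 a h2).2)).elim
        · intro h
          exact (hn ((memVC v).1 (Finset.mem_image.2 ⟨a, Finset.mem_inter.2 ⟨ha, h2⟩, h⟩))).elim
      · rw [JE1 a ha h2]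
    · have h2 : a ∈ G2.A := ((JA a).1 ha).resolve_left hna
      rw [JW2 a h2 hna, JE2 a h2]
      exact ⟨fun h => n2 (h ▸ (wf2 a h2).1), fun h => n2 (h ▸ (wf2 a h2).2)⟩
  have loc2 : ∀ v, v ∈ G2.V → ¬ isC v →
      (∀ a ∈ G2.A, (J.W a = v ↔ G2.W a = v) ∧ (J.E a = v ↔ G2.E a = v)) ∧
      (∀ a ∈ J.A, a ∉ G2.A → J.W a ≠ v ∧ J.E a ≠ v) := by
    intro v hv hn
    have n1 : v ∉ G1.V := fun h => hn (f1 v h hv)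
    refine ⟨fun a ha => ⟨?_, by rw [JE2 a ha]⟩, fun a ha hna => ?_⟩
    · by_cases h1 : a ∈ G1.A
      · rw [JW1 a h1]
        constructor
        · intro h; exact (n1 (h ▸ (wf1 a h1).1)).elim
        · intro h
          refine (hn ((memVC v).1 (Finset.mem_image.2 ⟨a, Finset.mem_inter.2 ⟨h1, ha⟩, ?_⟩))).elim
          rw [(hC a (Finset.mem_inter.2 ⟨h1, ha⟩)).1, h]
      · rw [JW2 a ha h1]
    · have h1 : a ∈ G1.A := ((JA a).1 ha).resolve_right hna
      rw [JW1 a h1, JE1 a h1 hna]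
      exact ⟨fun h => n1 (h ▸ (wf1 a h1).1), fun h => n1 (h ▸ (wf1 a h1).2)⟩
  have xv1 : ∀ X v, v ∈ G1.V → ¬ isC v → (J.XVertex X v ↔ G1.XVertex X v) := by
    intro X v hv hn
    obtain ⟨l1, l2⟩ := loc1 v hv hn
    have hvJ : v ∈ J.V := (JV v).2 ⟨Or.inl hv, hn⟩
    cases X
    · simp only [DGr.XVertex, hvJ, hv, true_and, Bool.not_false, DGr.Xf]
      constructor
      · intro h a ha e; exact h a ((JA a).2 (Or.inl ha)) ((l1 a ha).1.2 e)
      · intro h a ha e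
        by_cases h1 : a ∈ G1.A
        · exact h a h1 ((l1 a h1).1.1 e)
        · exact (l2 a ha h1).1 e
    · simp only [DGr.XVertex, hvJ, hv, true_and, Bool.not_true, DGr.Xf]
      constructor
      · intro h a ha e; exact h a ((JA a).2 (Or.inl ha)) ((l1 a ha).2.2 e)
      · intro h a ha e
        by_cases h1 : a ∈ G1.A
        · exact h a h1 ((l1 a h1).2.1 e)
        · exact (l2 a ha h1).2 e
  have xv2 : ∀ X v, v ∈ G2.V → ¬ isC v → (J.XVertex X v ↔ G2.XVertex X v) := by
    intro X v hv hn
    obtain ⟨l1, l2⟩ := loc2 v hv hn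
    have hvJ : v ∈ J.V := (JV v).2 ⟨Or.inr hv, hn⟩
    cases X
    · simp only [DGr.XVertex, hvJ, hv, true_and, Bool.not_false, DGr.Xf]
      constructor
      · intro h a ha e; exact h a ((JA a).2 (Or.inr ha)) ((l1 a ha).1.2 e)
      · intro h a ha e
        by_cases h1 : a ∈ G2.A
        · exact h a h1 ((l1 a h1).1.1 e)
        · exact (l2 a ha h1).1 e
    · simp only [DGr.XVertex, hvJ, hv, true_and, Bool.not_true, DGr.Xf]
      constructor
      · intro h a ha e; exact h a ((JA a).2 (Or.inr ha)) ((l1 a ha).2.2 e)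
      · intro h a ha e
        by_cases h1 : a ∈ G2.A
        · exact h a h1 ((l1 a h1).2.1 e)
        · exact (l2 a ha h1).2 e
  -- positions of list members
  have pLWW : ∀ v ∈ LWW, v ∈ G1.V ∧ ¬ isC v := by
    intro v h
    have hx := (i1.lw.2 v).1 h
    refine ⟨hx.1, ?_⟩
    rintro ⟨c, h1, h2, h3, h4⟩
    exact hx.2 c h1 h3
  have pLEE : ∀ v ∈ LEE, v ∈ G2.V ∧ ¬ isC v := by
    intro v h
    have hx := (i2.le.2 v).1 h
    refine ⟨hx.1, ?_⟩
    rintro ⟨c, h1, h2, h3, h4⟩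
    exact hx.2 c h2 h4
  have pΦe : ∀ v ∈ Φe, v ∈ G1.V ∧ ¬ isC v := fun v h =>
    ⟨((i1.le.2 v).1 (by simp [h])).1, fun hc => d1 h ((memXi v).2 hc)⟩
  have pΨe : ∀ v ∈ Ψe, v ∈ G1.V ∧ ¬ isC v := fun v h =>
    ⟨((i1.le.2 v).1 (by simp [h])).1, fun hc => d3 ((memXi v).2 hc) h⟩
  have pΦw : ∀ v ∈ Φw, v ∈ G2.V ∧ ¬ isC v := fun v h =>
    ⟨((i2.lw.2 v).1 (by simp [h])).1, fun hc => d4 h ((memXi v).2 hc)⟩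
  have pΨw : ∀ v ∈ Ψw, v ∈ G2.V ∧ ¬ isC v := fun v h =>
    ⟨((i2.lw.2 v).1 (by simp [h])).1, fun hc => d6 ((memXi v).2 hc) h⟩
  have n1 := i1.le.1
  have n2 := i2.lw.1
  simp only [List.nodup_append'] at n1 n2
  have dd : ∀ v, (v ∈ G1.V ∧ ¬ isC v) → (v ∈ G2.V ∧ ¬ isC v) → False :=
    fun v h h' => h.2 (f1 v h.1 h'.1)
  refine ⟨⟨?_, ?_⟩, ⟨?_, ?_⟩, ?_, ?_⟩
  · simp only [List.nodup_append', List.disjoint_append_left]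
    exact ⟨⟨n2.1.1, i1.lw.1, fun v h h' => dd v (pLWW v h') (pΦw v h)⟩, n2.2.1,
      d5, fun v h h' => dd v (pLWW v h) (pΨw v h')⟩
  · intro v
    simp only [List.mem_append]
    constructor
    · rintro ((h | h) | h)
      · exact (xv2 _ v (pΦw v h).1 (pΦw v h).2).2 ((i2.lw.2 v).1 (by simp [h]))
      · exact (xv1 _ v (pLWW v h).1 (pLWW v h).2).2 ((i1.lw.2 v).1 h)
      · exact (xv2 _ v (pΨw v h).1 (pΨw v h).2).2 ((i2.lw.2 v).1 (by simp [h]))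
    · intro h
      obtain ⟨hv | hv, hn⟩ := (JV v).1 h.1
      · exact Or.inl (Or.inr ((i1.lw.2 v).2 ((xv1 _ v hv hn).1 h)))
      · have := (i2.lw.2 v).2 ((xv2 _ v hv hn).1 h)
        simp only [List.mem_append, memXi] at this
        rcases this with (h | h) | h
        · exact Or.inl (Or.inl h)
        · exact (hn h).elim
        · exact Or.inr h
  · simp only [List.nodup_append', List.disjoint_append_left]
    exact ⟨⟨n1.1.1, i2.le.1, fun v h h' => dd v (pΦe v h) (pLEE v h')⟩, n1.2.1,
      d2, fun v h h' => dd v (pΨe v h') (pLEE v h)⟩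
  · intro v
    simp only [List.mem_append]
    constructor
    · rintro ((h | h) | h)
      · exact (xv1 _ v (pΦe v h).1 (pΦe v h).2).2 ((i1.le.2 v).1 (by simp [h]))
      · exact (xv2 _ v (pLEE v h).1 (pLEE v h).2).2 ((i2.le.2 v).1 h)
      · exact (xv1 _ v (pΨe v h).1 (pΨe v h).2).2 ((i1.le.2 v).1 (by simp [h]))
    · intro h
      obtain ⟨hv | hv, hn⟩ := (JV v).1 h.1
      · have := (i1.le.2 v).2 ((xv1 _ v hv hn).1 h)
        simp only [List.mem_append, memXi] at this
        rcases this with (h | h) | h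
        · exact Or.inl (Or.inl h)
        · exact (hn h).elim
        · exact Or.inr h
      · exact Or.inl (Or.inr ((i2.le.2 v).2 ((xv2 _ v hv hn).1 h)))
  · intro v h h'
    simp only [List.mem_append] at h h'
    rcases h with (h | h) | h <;> rcases h' with (h' | h') | h'
    · exact d7 h' h
    · exact i2.dis (by simp [h]) h'
    · exact d9 h' h
    · exact i1.dis h (by simp [h'])
    · exact dd v (pLWW v h) (pLEE v h')
    · exact i1.dis h (by simp [h'])
    · exact d8 h' h
    · exact i2.dis (by simp [h]) h'
    · exact d10 h' h
  · intro f g hf hg hd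
    have b1 : ∀ f v, v ∈ G1.V → ¬ isC v → bd J f v = bd G1 f v := fun f v hv hn =>
      bd_agree f (fun a h => (JA a).2 (Or.inl h)) (loc1 v hv hn).1 (loc1 v hv hn).2
    have b2 : ∀ f v, v ∈ G2.V → ¬ isC v → bd J f v = bd G2 f v := fun f v hv hn =>
      bd_agree f (fun a h => (JA a).2 (Or.inr h)) (loc2 v hv hn).1 (loc2 v hv hn).2
    have in1 : ∀ f : ℕ → F2, (∀ v, J.InnerVertex v → bd J f v = 0) →
        ∀ v, G1.InnerVertex v → bd G1 f v = 0 := by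
      intro f hf v hv
      have hn : ¬ isC v := fun h => hv.2.2 (f2 v h).1
      rw [← b1 f v hv.1 hn]
      exact hf v ⟨(JV v).2 ⟨Or.inl hv.1, hn⟩, by rw [xv1 _ v hv.1 hn]; exact hv.2.1,
        by rw [xv1 _ v hv.1 hn]; exact hv.2.2⟩
    have in2 : ∀ f : ℕ → F2, (∀ v, J.InnerVertex v → bd J f v = 0) →
        ∀ v, G2.InnerVertex v → bd G2 f v = 0 := by
      intro f hf v hv
      have hn : ¬ isC v := fun h => hv.2.1 (f2 v h).2
      rw [← b2 f v hv.1 hn]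
      exact hf v ⟨(JV v).2 ⟨Or.inr hv.1, hn⟩, by rw [xv2 _ v hv.1 hn]; exact hv.2.1,
        by rw [xv2 _ v hv.1 hn]; exact hv.2.2⟩
    -- values at the cut
    have c1 : ∀ f c, c ∈ G1.A → c ∈ G2.A → bd G1 f (G1.E c) = f c := by
      intro f c h1 h2
      have hc := (hC c (Finset.mem_inter.2 ⟨h1, h2⟩)).2.1
      have hW : ∀ b ∈ G1.A, G1.W b ≠ G1.E c := hc.2.2
      have hE : ∀ b ∈ G1.A, b ≠ c → G1.E b ≠ G1.E c := fn1 false c hc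
      unfold bd
      rw [Finset.sum_eq_single c]
      · simp [hW c h1]
      · intro b hb hne; simp [hW b hb, hE b hb hne]
      · exact fun h => (h h1).elim
    have c2 : ∀ f c, c ∈ G1.A → c ∈ G2.A → bd G2 f (G2.W c) = f c := by
      intro f c h1 h2
      have hc := (hC c (Finset.mem_inter.2 ⟨h1, h2⟩)).2.2
      have hE : ∀ b ∈ G2.A, G2.E b ≠ G2.W c := hc.2.2
      have hW : ∀ b ∈ G2.A, b ≠ c → G2.W b ≠ G2.W c := fn2 true c hc
      unfold bd
      rw [Finset.sum_eq_single c]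
      · simp [hE c h2]
      · intro b hb hne; simp [hE b hb, hW b hb hne]
      · exact fun h => (h h2).elim
    have cX : ∀ f, ∀ v ∈ Ξ, bd G1 f v = bd G2 f v := by
      intro f v hv
      obtain ⟨c, h1, h2, h3, h4⟩ := (memXi v).1 hv
      have a1 := c1 f c h1 h2
      have a2 := c2 f c h1 h2
      rw [h3] at a1; rw [h4] at a2; rw [a1, a2]
    have cM : ∀ v ∈ Ξ, bd G2 f v * bd G2 g v = 0 := by
      intro v hv
      obtain ⟨c, h1, h2, h3, h4⟩ := (memXi v).1 hv
      have a1 := c2 f c h1 h2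
      have a2 := c2 g c h1 h2
      rw [h4] at a1 a2; rw [a1, a2]
      by_contra hne
      have hJc := (JA c).2 (Or.inl h1)
      exact (hd c hJc c hJc (left_ne_zero_of_mul hne) (right_ne_zero_of_mul hne)).1 rfl
    have D1 : Dj G1 f g := by
      intro a ha b hb hfa hgb
      obtain ⟨e1, e2, e3, e4⟩ := hd a ((JA a).2 (Or.inl ha)) b ((JA b).2 (Or.inl hb)) hfa hgb
      rw [JW1 a ha] at e1 e2
      rw [JW1 b hb] at e1 e3
      have hab : a ≠ b := fun h => e1 (by rw [h])
      have key : ∀ c ∈ G1.A, c ∈ G2.A → (∀ b ∈ G1.A, G1.W b ≠ G1.E c) ∧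
          ∀ b ∈ G1.A, b ≠ c → G1.E b ≠ G1.E c := by
        intro c h1 h2
        have hc := (hC c (Finset.mem_inter.2 ⟨h1, h2⟩)).2.1
        exact ⟨hc.2.2, fn1 false c hc⟩
      by_cases ha2 : a ∈ G2.A
      · have k := key a ha ha2
        refine ⟨e1, ?_, (k.1 b hb).symm, (k.2 b hb hab.symm).symm⟩
        by_cases hb2 : b ∈ G2.A
        · exact (key b hb hb2).1 a ha
        · rwa [JE1 b hb hb2] at e2
      · rw [JE1 a ha ha2] at e3 e4
        by_cases hb2 : b ∈ G2.A
        · have k := key b hb hb2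
          exact ⟨e1, k.1 a ha, e3, k.2 a ha hab⟩
        · rw [JE1 b hb hb2] at e2 e4
          exact ⟨e1, e2, e3, e4⟩
    have D2 : Dj G2 f g := by
      intro a ha b hb hfa hgb
      obtain ⟨e1, e2, e3, e4⟩ := hd a ((JA a).2 (Or.inr ha)) b ((JA b).2 (Or.inr hb)) hfa hgb
      rw [JE2 a ha] at e3 e4
      rw [JE2 b hb] at e2 e4
      have hab : a ≠ b := fun h => e4 (by rw [h])
      have key : ∀ c ∈ G2.A, c ∈ G1.A → (∀ b ∈ G2.A, G2.E b ≠ G2.W c) ∧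
          ∀ b ∈ G2.A, b ≠ c → G2.W b ≠ G2.W c := by
        intro c h1 h2
        have hc := (hC c (Finset.mem_inter.2 ⟨h2, h1⟩)).2.2
        exact ⟨hc.2.2, fn2 true c hc⟩
      by_cases ha2 : a ∈ G1.A
      · have k := key a ha ha2
        refine ⟨(k.2 b hb hab.symm).symm, (k.1 b hb).symm, ?_, e4⟩
        by_cases hb2 : b ∈ G1.A
        · exact (key b hb hb2).1 a ha
        · rwa [JW2 b hb hb2] at e3
      · rw [JW2 a ha ha2] at e1 e2
        by_cases hb2 : b ∈ G1.A
        · have k := key b hb hb2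
          exact ⟨k.2 a ha hab, e2, k.1 a ha, e4⟩
        · rw [JW2 b hb hb2] at e1 e3
          exact ⟨e1, e2, e3, e4⟩
    have H1 := i1.H f g (in1 f hf) (in1 g hg) D1
    have H2 := i2.H f g (in2 f hf) (in2 g hg) D2
    have T1f := total i1 wf1 f (in1 f hf)
    have T1g := total i1 wf1 g (in1 g hg)
    have T2f := total i2 wf2 f (in2 f hf)
    have T2g := total i2 wf2 g (in2 g hg)
    have hX := pr_swap cM
    simp only [List.reverse_append, pr_append, sm_append, pr_reverse, sm_reverse] at H1 H2 T1f T1g T2f T2g ⊢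
    have s1 : ∀ l : List ℕ, (∀ v ∈ l, v ∈ G1.V ∧ ¬ isC v) → ∀ f, sm l (bd J f) = sm l (bd G1 f) :=
      fun l h f => sm_congr fun v hv => b1 f v (h v hv).1 (h v hv).2
    have s2 : ∀ l : List ℕ, (∀ v ∈ l, v ∈ G2.V ∧ ¬ isC v) → ∀ f, sm l (bd J f) = sm l (bd G2 f) :=
      fun l h f => sm_congr fun v hv => b2 f v (h v hv).1 (h v hv).2
    have p1 : ∀ l : List ℕ, (∀ v ∈ l, v ∈ G1.V ∧ ¬ isC v) → ∀ f g,
        pr l (bd J f) (bd J g) = pr l (bd G1 f) (bd G1 g) :=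
      fun l h f g => pr_congr (fun v hv => b1 f v (h v hv).1 (h v hv).2)
        (fun v hv => b1 g v (h v hv).1 (h v hv).2)
    have p2 : ∀ l : List ℕ, (∀ v ∈ l, v ∈ G2.V ∧ ¬ isC v) → ∀ f g,
        pr l (bd J f) (bd J g) = pr l (bd G2 f) (bd G2 g) :=
      fun l h f g => pr_congr (fun v hv => b2 f v (h v hv).1 (h v hv).2)
        (fun v hv => b2 g v (h v hv).1 (h v hv).2)
    simp only [s1 _ pLWW, s1 _ pΦe, s1 _ pΨe, s2 _ pLEE, s2 _ pΦw, s2 _ pΨw,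
      p1 _ pLWW, p1 _ pΦe, p1 _ pΨe, p2 _ pLEE, p2 _ pΦw, p2 _ pΨw]
    simp only [sm_congr (cX _), pr_congr (cX _) (cX _)] at H1 T1f T1g
    clear s1 s2 p1 p2 cX cM c1 c2 b1 b2 in1 in2 D1 D2 dd n1 n2 pLWW pLEE pΦe pΦw pΨe pΨw xv1 xv2 loc1 loc2
    clear memXi f1 f2 memVC JV JA JW1 JW2 JE1 JE2 hd hf hg hV hC fn1 fn2 wf1 wf2 i1 i2
    clear d1 d2 d3 d4 d5 d6 d7 d8 d9 d10
    rcases hΦ with rfl | rfl <;> rcases hΨ with rfl | rfl <;>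
      simp only [pr_nil, sm_nil, zero_mul, mul_zero, add_zero, zero_add] at H1 H2 T1f T1g T2f T2g ⊢ <;>
      grind

end PfG

/-- **Proposition 2.2.1**: for a construction with root triple `(D, L_W, L_E)`:
(1) if `x <_{L_W} y` and `z <_{L_E} u`, then every semipath in `[x,u]` and every
semipath in `[y,z]` intersect; (2) if `L_X : x−y−z` then `ψ_X(x,y,z)`, so that
in particular `L_W` and `L_E` are grounded in `D`; (3) if `L_X : x−y−u−z`, then
every semipath in `[x,u]` and every semipath in `[y,z]` intersect. -/
theorem construction_root_lists_grounded (D : DGr) (LW LE : List ℕ)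
    (hK : Construction D LW LE) :
    (∀ x y z u, ltL LW x y → ltL LE z u →
      ∀ vs₁ es₁, D.SemipathFT x u vs₁ es₁ → ∀ vs₂ es₂, D.SemipathFT y z vs₂ es₂ →
        ∃ w, w ∈ vs₁ ∧ w ∈ vs₂) ∧
    (∀ x y z, BtwL LW x y z → D.psi true x y z) ∧
    (∀ x y z, BtwL LE x y z → D.psi false x y z) ∧
    D.GroundedIn true LW ∧ D.GroundedIn false LE ∧
    (∀ x y u z, Btw4L LW x y u z →
      ∀ vs₁ es₁, D.SemipathFT x u vs₁ es₁ → ∀ vs₂ es₂, D.SemipathFT y z vs₂ es₂ →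
        ∃ w, w ∈ vs₁ ∧ w ∈ vs₂) ∧
    (∀ x y u z, Btw4L LE x y u z →
      ∀ vs₁ es₁, D.SemipathFT x u vs₁ es₁ → ∀ vs₂ es₂, D.SemipathFT y z vs₂ es₂ →
        ∃ w, w ∈ vs₁ ∧ w ∈ vs₂) := by
  have hI : PfG.Inv D LW LE := by
    induction hK with
    | basic G LW LE h1 h2 h3 => exact PfG.inv_basic h1 h2 h3
    | box GW GE LWW LEE Φe Ξ Ψe Φw Ψw _ _ hJ _ hΦ hΨ d1 d2 d3 d4 d5 d6 d7 d8 d9 d10 i1 i2 =>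
      exact PfG.inv_box i1 i2 hJ hΦ hΨ d1 d2 d3 d4 d5 d6 d7 d8 d9 d10
  have A : ∀ {x y}, ltL LW x y → ltL (LW ++ LE.reverse) x y := fun h =>
    (PfG.ltL_append _ _ _ _).2 (Or.inl h)
  have B : ∀ {x y}, ltL LE x y → ltL (LW ++ LE.reverse) y x := fun h =>
    (PfG.ltL_append _ _ _ _).2 (Or.inr (Or.inl ((PfG.ltL_reverse _ _ _).2 h)))
  have M : ∀ {x y}, x ∈ LW → y ∈ LE → ltL (LW ++ LE.reverse) x y := fun h h' =>
    (PfG.ltL_append _ _ _ _).2 (Or.inr (Or.inr ⟨h, List.mem_reverse.2 h'⟩))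
  have sw : ∀ {S T : List ℕ}, (∃ w, w ∈ S ∧ w ∈ T) → ∃ w, w ∈ T ∧ w ∈ S :=
    fun ⟨w, h, h'⟩ => ⟨w, h', h⟩
  have P2 : ∀ x y z, BtwL LW x y z → D.psi true x y z := by
    intro x y z h vs₁ es₁ p t vs₂ es₂ ht q
    have ht : t ∈ LE := (hI.le.2 t).2 ht
    have p := PfG.con_sp p
    have q := PfG.con_sp q
    rcases h with ⟨h, h'⟩ | ⟨h, h'⟩
    · exact hI.cross (A h) (A h') (M (PfG.ltL_mem h').2 ht) p q
    · exact hI.cross (A h) (A h') (M (PfG.ltL_mem h').2 ht) p.symm q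
  have P3 : ∀ x y z, BtwL LE x y z → D.psi false x y z := by
    intro x y z h vs₁ es₁ p t vs₂ es₂ ht q
    have ht : t ∈ LW := (hI.lw.2 t).2 ht
    have p := PfG.con_sp p
    have q := PfG.con_sp q
    rcases h with ⟨h, h'⟩ | ⟨h, h'⟩
    · exact sw (hI.cross (M ht (PfG.ltL_mem h').2) (B h') (B h) q.symm p.symm)
    · exact sw (hI.cross (M ht (PfG.ltL_mem h').2) (B h') (B h) q.symm p)
  refine ⟨?_, P2, P3, P2, P3, ?_, ?_⟩
  · intro x y z u h h' vs₁ es₁ p vs₂ es₂ q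
    exact hI.cross (A h) (M (PfG.ltL_mem h).2 (PfG.ltL_mem h').2) (B h')
      (PfG.con_sp p) (PfG.con_sp q)
  · intro x y u z h vs₁ es₁ p vs₂ es₂ q
    have p := PfG.con_sp p
    have q := PfG.con_sp q
    rcases h with ⟨h1, h2, h3⟩ | ⟨h1, h2, h3⟩
    · exact hI.cross (A h1) (A h2) (A h3) p q
    · exact sw (hI.cross (A h1) (A h2) (A h3) q.symm p.symm)
  · intro x y u z h vs₁ es₁ p vs₂ es₂ q
    have p := PfG.con_sp p
    have q := PfG.con_sp q
    rcases h with ⟨h1, h2, h3⟩ | ⟨h1, h2, h3⟩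
    · exact sw (hI.cross (B h3) (B h2) (B h1) q.symm p.symm)
    · exact hI.cross (B h3) (B h2) (B h1) p q
end

section
/- If the chains ⟨Γ₁ˢ, R_{Γ₁}⟩ and ⟨Γ₂ˢ, R_{Γ₂}⟩ of non-empty lists Γ₁ and Γ₂ are compatible, then: (1) C := Γ₁ˢ ∩ Γ₂ˢ ≠ ∅; (2) ⟨C, R_{Γ₁} ∩ C²⟩ and ⟨C, R_{Γ₂} ∩ C²⟩ are chains; (3) R_{Γ₁} ∩ C² = R_{Γ₂} ∩ C²; (4) there are no x, y ∉ C and z ∈ C such that (x R_{Γ₁} z and y R_{Γ₂} z) or (z R_{Γ₁} x and z R_{Γ₂} y). -/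
/-- The relation `R_Γ` of a list: `x R_Γ y` iff `y` immediately follows `x` in `Γ`. -/
def listRel (Γ : List ℕ) (x y : ℕ) : Prop := (x, y) ∈ Γ.zip Γ.tail

/-- `⟨C, R⟩` is a chain: there is a list `Δ` (of distinct elements) whose set of
members is `C` and whose relation of immediate succession is `R`. -/
def IsChainOf (C : Set ℕ) (R : ℕ → ℕ → Prop) : Prop :=
  ∃ Δ : List ℕ, Δ.Nodup ∧ (∀ x, x ∈ Δ ↔ x ∈ C) ∧ ∀ x y, R x y ↔ listRel Δ x y

/-- The chains of `Γ₁` and `Γ₂` are compatible: there is a list `Γ` with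
`⟨Γˢ, R_Γ⟩ = ⟨Γ₁ˢ ∪ Γ₂ˢ, R_{Γ₁} ∪ R_{Γ₂}⟩`. -/
def ChainsCompatible (Γ₁ Γ₂ : List ℕ) : Prop :=
  ∃ Γ : List ℕ, Γ.Nodup ∧ (∀ x, x ∈ Γ ↔ (x ∈ Γ₁ ∨ x ∈ Γ₂)) ∧
    ∀ x y, listRel Γ x y ↔ (listRel Γ₁ x y ∨ listRel Γ₂ x y)

theorem listRel_iff (L : List ℕ) (x y : ℕ) :
    listRel L x y ↔ ∃ i : ℕ, L[i]? = some x ∧ L[i+1]? = some y := by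
  unfold listRel
  rw [List.mem_iff_getElem?]
  simp [List.getElem?_zip_eq_some]

/-- `L` is the window of `G` starting at `a`. -/
def IsWin (L G : List ℕ) (a : ℕ) : Prop :=
  a + L.length ≤ G.length ∧ ∀ k, k < L.length → L[k]? = G[a+k]?

theorem IsWin.mem {L G : List ℕ} {a : ℕ} (h : IsWin L G a) (x : ℕ) :
    x ∈ L ↔ ∃ i, a ≤ i ∧ i < a + L.length ∧ G[i]? = some x := by
  rw [List.mem_iff_getElem?]
  constructor
  · rintro ⟨k, hk⟩
    have hl : k < L.length := (List.getElem?_eq_some_iff.1 hk).1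
    exact ⟨a + k, by omega, by omega, by rw [← h.2 k hl, hk]⟩
  · rintro ⟨i, h1, h2, h3⟩
    refine ⟨i - a, ?_⟩
    rw [h.2 _ (by omega), ← h3]
    congr 1
    omega

theorem IsWin.rel {L G : List ℕ} {a : ℕ} (h : IsWin L G a) (x y : ℕ) :
    listRel L x y ↔
      ∃ i, a ≤ i ∧ i + 1 < a + L.length ∧ G[i]? = some x ∧ G[i+1]? = some y := by
  rw [listRel_iff]
  constructor
  · rintro ⟨k, hk, hk'⟩
    have hl : k + 1 < L.length := (List.getElem?_eq_some_iff.1 hk').1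
    refine ⟨a + k, by omega, by omega, by rw [← h.2 k (by omega), hk], ?_⟩
    rw [Nat.add_assoc, ← h.2 _ hl, hk']
  · rintro ⟨i, h1, h2, h3, h4⟩
    refine ⟨i - a, ?_, ?_⟩
    · rw [h.2 _ (by omega), ← h3]
      congr 1
      omega
    · rw [h.2 _ (by omega), ← h4]
      congr 1
      omega

theorem idx_inj {G : List ℕ} (hG : G.Nodup) {i j x : ℕ} (hi : G[i]? = some x)
    (hj : G[j]? = some x) : i = j := by
  obtain ⟨h, rfl⟩ := List.getElem?_eq_some_iff.1 hi
  obtain ⟨h', e⟩ := List.getElem?_eq_some_iff.1 hj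
  exact ((hG.getElem_inj_iff).1 e).symm

theorem exists_win {L G : List ℕ} (hG : G.Nodup) (hne : L ≠ [])
    (hs : ∀ x, x ∈ L → x ∈ G) (hr : ∀ x y, listRel L x y → listRel G x y) :
    ∃ a, IsWin L G a := by
  have hpos : 0 < L.length := List.length_pos_iff.2 hne
  obtain ⟨a, ha⟩ := List.mem_iff_getElem?.1 (hs L[0] (List.getElem_mem hpos))
  have key : ∀ k, k < L.length → L[k]? = G[a+k]? := by
    intro k
    induction k with
    | zero => intro _; simp only [Nat.add_zero]; rw [ha]; exact List.getElem?_eq_getElem hpos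
    | succ k ih =>
      intro hk
      have e := ih (by omega)
      have e1 : L[k]? = some (L[k]'(by omega)) := List.getElem?_eq_getElem _
      have e2 : L[k+1]? = some L[k+1] := List.getElem?_eq_getElem hk
      obtain ⟨i, hi, hi'⟩ := (listRel_iff _ _ _).1 (hr _ _ ((listRel_iff _ _ _).2 ⟨k, e1, e2⟩))
      have : i = a + k := idx_inj hG hi (by rw [← e, e1])
      subst this
      rw [e2, ← hi', Nat.add_assoc]
  refine ⟨a, ?_, key⟩
  have e := key (L.length - 1) (by omega)
  rw [List.getElem?_eq_getElem (by omega)] at e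
  have := (List.getElem?_eq_some_iff.1 e.symm).1
  omega

theorem isWin_take_drop (G : List ℕ) (c d : ℕ) (h : c + d ≤ G.length) :
    IsWin ((G.drop c).take d) G c ∧ ((G.drop c).take d).length = d := by
  have hl : ((G.drop c).take d).length = d := by simp; omega
  refine ⟨⟨by omega, fun k hk => ?_⟩, hl⟩
  rw [List.getElem?_take_of_lt (by omega), List.getElem?_drop]

/-- **Proposition 1.7.2**: if the chains of the non-empty lists `Γ₁` and `Γ₂`
are compatible, then (1) `C := Γ₁ˢ ∩ Γ₂ˢ ≠ ∅`, (2) `⟨C, R_{Γ₁} ∩ C²⟩` and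
`⟨C, R_{Γ₂} ∩ C²⟩` are chains, (3) `R_{Γ₁} ∩ C² = R_{Γ₂} ∩ C²`, and (4) there
are no `x, y ∉ C` and `z ∈ C` with (`x R_{Γ₁} z` and `y R_{Γ₂} z`) or
(`z R_{Γ₁} x` and `z R_{Γ₂} y`). -/
theorem compatible_chains_properties (Γ₁ Γ₂ : List ℕ)
    (h₁ : Γ₁.Nodup) (h₂ : Γ₂.Nodup) (hne₁ : Γ₁ ≠ []) (hne₂ : Γ₂ ≠ [])
    (hc : ChainsCompatible Γ₁ Γ₂) :
    (∃ x, x ∈ Γ₁ ∧ x ∈ Γ₂) ∧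
    IsChainOf {x | x ∈ Γ₁ ∧ x ∈ Γ₂}
      (fun x y => listRel Γ₁ x y ∧ (x ∈ Γ₁ ∧ x ∈ Γ₂) ∧ (y ∈ Γ₁ ∧ y ∈ Γ₂)) ∧
    IsChainOf {x | x ∈ Γ₁ ∧ x ∈ Γ₂}
      (fun x y => listRel Γ₂ x y ∧ (x ∈ Γ₁ ∧ x ∈ Γ₂) ∧ (y ∈ Γ₁ ∧ y ∈ Γ₂)) ∧
    (∀ x y, (listRel Γ₁ x y ∧ (x ∈ Γ₁ ∧ x ∈ Γ₂) ∧ (y ∈ Γ₁ ∧ y ∈ Γ₂)) ↔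
            (listRel Γ₂ x y ∧ (x ∈ Γ₁ ∧ x ∈ Γ₂) ∧ (y ∈ Γ₁ ∧ y ∈ Γ₂))) ∧
    (¬ ∃ x y z, ¬ (x ∈ Γ₁ ∧ x ∈ Γ₂) ∧ ¬ (y ∈ Γ₁ ∧ y ∈ Γ₂) ∧ (z ∈ Γ₁ ∧ z ∈ Γ₂) ∧
      ((listRel Γ₁ x z ∧ listRel Γ₂ y z) ∨ (listRel Γ₁ z x ∧ listRel Γ₂ z y))) := by
  obtain ⟨G, hG, hm, hr⟩ := hc
  obtain ⟨a, wa⟩ := exists_win hG hne₁ (fun x hx => (hm x).2 (Or.inl hx))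
    (fun x y hx => (hr x y).2 (Or.inl hx))
  obtain ⟨b, wb⟩ := exists_win hG hne₂ (fun x hx => (hm x).2 (Or.inr hx))
    (fun x y hx => (hr x y).2 (Or.inr hx))
  have p1 : 0 < Γ₁.length := List.length_pos_iff.2 hne₁
  have p2 : 0 < Γ₂.length := List.length_pos_iff.2 hne₂
  have la := wa.1
  have lb := wb.1
  have m1 : ∀ i x, G[i]? = some x → (x ∈ Γ₁ ↔ a ≤ i ∧ i < a + Γ₁.length) := by
    intro i x hi
    rw [wa.mem]
    constructor
    · rintro ⟨j, h1, h2, h3⟩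
      obtain rfl := idx_inj hG hi h3
      exact ⟨h1, h2⟩
    · rintro ⟨h1, h2⟩
      exact ⟨i, h1, h2, hi⟩
  have m2 : ∀ i x, G[i]? = some x → (x ∈ Γ₂ ↔ b ≤ i ∧ i < b + Γ₂.length) := by
    intro i x hi
    rw [wb.mem]
    constructor
    · rintro ⟨j, h1, h2, h3⟩
      obtain rfl := idx_inj hG hi h3
      exact ⟨h1, h2⟩
    · rintro ⟨h1, h2⟩
      exact ⟨i, h1, h2, hi⟩
  have edge : ∀ i, i + 1 < G.length →
      (a ≤ i ∧ i + 1 < a + Γ₁.length) ∨ (b ≤ i ∧ i + 1 < b + Γ₂.length) := by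
    intro i hi
    have e1 : G[i]? = some (G[i]'(by omega)) := List.getElem?_eq_getElem _
    have e2 : G[i+1]? = some G[i+1] := List.getElem?_eq_getElem hi
    rcases (hr _ _).1 ((listRel_iff _ _ _).2 ⟨i, e1, e2⟩) with h | h
    · obtain ⟨j, h1, h2, h3, h4⟩ := (wa.rel _ _).1 h
      obtain rfl := idx_inj hG e1 h3
      exact Or.inl ⟨h1, h2⟩
    · obtain ⟨j, h1, h2, h3, h4⟩ := (wb.rel _ _).1 h
      obtain rfl := idx_inj hG e1 h3
      exact Or.inr ⟨h1, h2⟩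
  have ov1 : b < a + Γ₁.length := by
    by_contra hcon
    have := edge (a + Γ₁.length - 1) (by omega)
    omega
  have ov2 : a < b + Γ₂.length := by
    by_contra hcon
    have := edge (b + Γ₂.length - 1) (by omega)
    omega
  obtain ⟨c, hcdef⟩ : ∃ c, c = max a b := ⟨_, rfl⟩
  obtain ⟨d, hd⟩ : ∃ d, d = min (a + Γ₁.length) (b + Γ₂.length) - c := ⟨_, rfl⟩
  obtain ⟨wc, lc⟩ := isWin_take_drop G c d (by omega)
  have hC : ∀ x, x ∈ (G.drop c).take d ↔ (x ∈ Γ₁ ∧ x ∈ Γ₂) := by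
    intro x
    rw [wc.mem, lc]
    constructor
    · rintro ⟨i, h1, h2, h3⟩
      rw [m1 i x h3, m2 i x h3]
      omega
    · rintro ⟨hx, hy⟩
      obtain ⟨i, h1, h2, h3⟩ := (wa.mem x).1 hx
      have := (m2 i x h3).1 hy
      exact ⟨i, by omega, by omega, h3⟩
  have R1 : ∀ x y, (listRel Γ₁ x y ∧ (x ∈ Γ₁ ∧ x ∈ Γ₂) ∧ (y ∈ Γ₁ ∧ y ∈ Γ₂)) ↔
      listRel ((G.drop c).take d) x y := by
    intro x y
    rw [wc.rel, wa.rel, lc]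
    constructor
    · rintro ⟨⟨i, h1, h2, h3, h4⟩, ⟨_, q1⟩, ⟨_, q2⟩⟩
      rw [m2 _ _ h3] at q1
      rw [m2 _ _ h4] at q2
      exact ⟨i, by omega, by omega, h3, h4⟩
    · rintro ⟨i, h1, h2, h3, h4⟩
      refine ⟨⟨i, by omega, by omega, h3, h4⟩, ?_⟩
      rw [m1 _ _ h3, m2 _ _ h3, m1 _ _ h4, m2 _ _ h4]
      omega
  have R2 : ∀ x y, (listRel Γ₂ x y ∧ (x ∈ Γ₁ ∧ x ∈ Γ₂) ∧ (y ∈ Γ₁ ∧ y ∈ Γ₂)) ↔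
      listRel ((G.drop c).take d) x y := by
    intro x y
    rw [wc.rel, wb.rel, lc]
    constructor
    · rintro ⟨⟨i, h1, h2, h3, h4⟩, ⟨q1, _⟩, ⟨q2, _⟩⟩
      rw [m1 _ _ h3] at q1
      rw [m1 _ _ h4] at q2
      exact ⟨i, by omega, by omega, h3, h4⟩
    · rintro ⟨i, h1, h2, h3, h4⟩
      refine ⟨⟨i, by omega, by omega, h3, h4⟩, ?_⟩
      rw [m1 _ _ h3, m2 _ _ h3, m1 _ _ h4, m2 _ _ h4]
      omega
  have nd : ((G.drop c).take d).Nodup :=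
    hG.sublist ((List.take_sublist _ _).trans (List.drop_sublist _ _))
  refine ⟨?_, ⟨_, nd, hC, R1⟩, ⟨_, nd, hC, R2⟩, fun x y => (R1 x y).trans (R2 x y).symm, ?_⟩
  · have hlt : c < G.length := by omega
    have e : G[c]? = some G[c] := List.getElem?_eq_getElem hlt
    refine ⟨G[c], ?_⟩
    rw [m1 _ _ e, m2 _ _ e]
    omega
  · rintro ⟨x, y, z, hx, hy, hz, ⟨r1, r2⟩ | ⟨r1, r2⟩⟩
    · obtain ⟨i, i1, i2, i3, i4⟩ := (wa.rel _ _).1 r1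
      obtain ⟨j, j1, j2, j3, j4⟩ := (wb.rel _ _).1 r2
      have := idx_inj hG i4 j4
      obtain rfl : i = j := by omega
      rw [m1 _ _ i3, m2 _ _ i3] at hx
      omega
    · obtain ⟨i, i1, i2, i3, i4⟩ := (wa.rel _ _).1 r1
      obtain ⟨j, j1, j2, j3, j4⟩ := (wb.rel _ _).1 r2
      obtain rfl := idx_inj hG i3 j3
      rw [m1 _ _ i4, m2 _ _ i4] at hx
      omega
end

section
/- If for the chains ⟨Γ₁ˢ, R_{Γ₁}⟩ and ⟨Γ₂ˢ, R_{Γ₂}⟩ of non-empty lists Γ₁ and Γ₂ we have: (1) C := Γ₁ˢ ∩ Γ₂ˢ ≠ ∅; (2) ⟨C, R_{Γ₁} ∩ C²⟩ and ⟨C, R_{Γ₂} ∩ C²⟩ are chains; (3) R_{Γ₁} ∩ C² = R_{Γ₂} ∩ C²; (4) there are no x, y ∉ C and z ∈ C such that (x R_{Γ₁} z and y R_{Γ₂} z) or (z R_{Γ₁} x and z R_{Γ₂} y); then the lists Γ₁ and Γ₂ are compatible. -/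
theorem listRel_iff_s8 (Γ : List ℕ) (x y : ℕ) :
    listRel Γ x y ↔ ∃ A B, Γ = A ++ x :: y :: B := by
  unfold listRel
  induction Γ with
  | nil => simp
  | cons a t ih =>
    cases t with
    | nil =>
      simp only [List.tail_cons, List.zip_nil_right, List.not_mem_nil, false_iff]
      rintro ⟨A, B, h⟩
      have := congrArg List.length h
      simp at this
      omega
    | cons b t =>
      simp only [List.tail_cons, List.zip_cons_cons, List.mem_cons, Prod.mk.injEq] at ih ⊢
      rw [ih]
      constructor
      · rintro (⟨rfl, rfl⟩ | ⟨A, B, h⟩)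
        · exact ⟨[], t, rfl⟩
        · exact ⟨a :: A, B, by rw [h]; rfl⟩
      · rintro ⟨A, B, h⟩
        cases A with
        | nil => left; simp at h; exact ⟨h.1.symm, h.2.1.symm⟩
        | cons c A => right; simp at h; exact ⟨A, B, h.2⟩

theorem nodup_split {A A' B B' : List ℕ} {b : ℕ} (hn : (A ++ b :: B).Nodup)
    (h : A ++ b :: B = A' ++ b :: B') : A = A' := by
  induction A generalizing A' with
  | nil =>
    cases A' with
    | nil => rfl
    | cons c A' => simp at h hn; obtain ⟨rfl, rfl⟩ := h; simp at hn
  | cons a A ih =>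
    cases A' with
    | nil => simp at h hn; obtain ⟨rfl, rfl⟩ := h; simp at hn
    | cons c A' =>
      simp only [List.cons_append, List.cons.injEq, List.nodup_cons] at h hn
      rw [h.1, ih hn.2 h.2]

theorem infix_of_rel (Γ : List ℕ) (hn : Γ.Nodup) : ∀ Δ : List ℕ, Δ ≠ [] → (∀ x ∈ Δ, x ∈ Γ) →
    (∀ x y, listRel Δ x y → listRel Γ x y) → ∃ A B, Γ = A ++ Δ ++ B := by
  intro Δ
  induction Δ with
  | nil => simp
  | cons a t ih =>
    intro _ hm hr
    cases t with
    | nil =>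
      obtain ⟨A, B, h⟩ := List.append_of_mem (hm a (by simp))
      exact ⟨A, B, by simp [h]⟩
    | cons b t =>
      obtain ⟨A, B, h⟩ := ih (by simp) (fun x hx => hm x (by simp [List.mem_cons.1 hx]))
        (fun x y hxy => hr x y (by
          rw [listRel_iff_s8] at hxy ⊢
          obtain ⟨A, B, h⟩ := hxy
          exact ⟨a :: A, B, by rw [h]; rfl⟩))
      obtain ⟨A', B', h'⟩ := (listRel_iff_s8 _ _ _).1 (hr a b ((listRel_iff_s8 _ _ _).2 ⟨[], t, rfl⟩))
      have e : A = A' ++ [a] := by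
        apply nodup_split (b := b) (B := t ++ B) (B' := B')
        · rw [h] at hn; simpa using hn
        · rw [h] at h'; simpa using h'
      exact ⟨A', B, by rw [h, e]; simp⟩

/-- **Proposition 1.7.3**: if for the chains of the non-empty lists `Γ₁`, `Γ₂`
we have (1) `C := Γ₁ˢ ∩ Γ₂ˢ ≠ ∅`, (2) `⟨C, R_{Γ₁} ∩ C²⟩` and `⟨C, R_{Γ₂} ∩ C²⟩`
are chains, (3) `R_{Γ₁} ∩ C² = R_{Γ₂} ∩ C²`, and (4) there are no `x, y ∉ C` and
`z ∈ C` with (`x R_{Γ₁} z` and `y R_{Γ₂} z`) or (`z R_{Γ₁} x` and `z R_{Γ₂} y`),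
then the lists `Γ₁` and `Γ₂` are compatible. -/
theorem chains_properties_imply_compatible (Γ₁ Γ₂ : List ℕ)
    (h₁ : Γ₁.Nodup) (h₂ : Γ₂.Nodup) (hne₁ : Γ₁ ≠ []) (hne₂ : Γ₂ ≠ [])
    (c1 : ∃ x, x ∈ Γ₁ ∧ x ∈ Γ₂)
    (c2a : IsChainOf {x | x ∈ Γ₁ ∧ x ∈ Γ₂}
      (fun x y => listRel Γ₁ x y ∧ (x ∈ Γ₁ ∧ x ∈ Γ₂) ∧ (y ∈ Γ₁ ∧ y ∈ Γ₂)))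
    (c2b : IsChainOf {x | x ∈ Γ₁ ∧ x ∈ Γ₂}
      (fun x y => listRel Γ₂ x y ∧ (x ∈ Γ₁ ∧ x ∈ Γ₂) ∧ (y ∈ Γ₁ ∧ y ∈ Γ₂)))
    (c3 : ∀ x y, (listRel Γ₁ x y ∧ (x ∈ Γ₁ ∧ x ∈ Γ₂) ∧ (y ∈ Γ₁ ∧ y ∈ Γ₂)) ↔
                 (listRel Γ₂ x y ∧ (x ∈ Γ₁ ∧ x ∈ Γ₂) ∧ (y ∈ Γ₁ ∧ y ∈ Γ₂)))
    (c4 : ¬ ∃ x y z, ¬ (x ∈ Γ₁ ∧ x ∈ Γ₂) ∧ ¬ (y ∈ Γ₁ ∧ y ∈ Γ₂) ∧ (z ∈ Γ₁ ∧ z ∈ Γ₂) ∧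
      ((listRel Γ₁ x z ∧ listRel Γ₂ y z) ∨ (listRel Γ₁ z x ∧ listRel Γ₂ z y))) :
    ListCompat Γ₁ Γ₂ := by
  obtain ⟨Δ, hΔ, hm, hr⟩ := c2a
  simp only [Set.mem_setOf_eq] at hm
  have hne : Δ ≠ [] := by
    rintro rfl
    obtain ⟨x, hx⟩ := c1
    simpa using (hm x).2 hx
  obtain ⟨A₁, B₁, e₁⟩ := infix_of_rel Γ₁ h₁ Δ hne (fun x hx => ((hm x).1 hx).1)
    (fun x y h => ((hr x y).2 h).1)
  obtain ⟨A₂, B₂, e₂⟩ := infix_of_rel Γ₂ h₂ Δ hne (fun x hx => ((hm x).1 hx).2)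
    (fun x y h => ((c3 x y).1 ((hr x y).2 h)).1)
  have n₁ := h₁
  have n₂ := h₂
  rw [e₁] at n₁
  rw [e₂] at n₂
  simp only [List.nodup_append', List.disjoint_append_left] at n₁ n₂
  obtain ⟨⟨a1, -, d1⟩, b1, f1, g1⟩ := n₁
  obtain ⟨⟨a2, -, d2⟩, b2, f2, g2⟩ := n₂
  have hA : A₁ = [] ∨ A₂ = [] := by
    by_contra! hc
    obtain ⟨P, x, hP⟩ := (List.eq_nil_or_concat' A₁).resolve_left hc.1
    obtain ⟨Q, y, hQ⟩ := (List.eq_nil_or_concat' A₂).resolve_left hc.2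
    obtain ⟨z, t, ht⟩ := List.exists_cons_of_ne_nil hne
    refine c4 ⟨x, y, z, ?_, ?_, (hm z).1 (by simp [ht]), Or.inl ⟨?_, ?_⟩⟩
    · rw [← hm]; exact d1 (by simp [hP])
    · rw [← hm]; exact d2 (by simp [hQ])
    · exact (listRel_iff_s8 _ _ _).2 ⟨P, t ++ B₁, by rw [e₁, hP, ht]; simp⟩
    · exact (listRel_iff_s8 _ _ _).2 ⟨Q, t ++ B₂, by rw [e₂, hQ, ht]; simp⟩
  have hB : B₁ = [] ∨ B₂ = [] := by
    by_contra! hc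
    obtain ⟨x, P, hP⟩ := List.exists_cons_of_ne_nil hc.1
    obtain ⟨y, Q, hQ⟩ := List.exists_cons_of_ne_nil hc.2
    obtain ⟨t, z, ht⟩ := (List.eq_nil_or_concat' Δ).resolve_left hne
    refine c4 ⟨x, y, z, ?_, ?_, (hm z).1 (by simp [ht]), Or.inr ⟨?_, ?_⟩⟩
    · rw [← hm]; exact fun h => g1 h (by simp [hP])
    · rw [← hm]; exact fun h => g2 h (by simp [hQ])
    · exact (listRel_iff_s8 _ _ _).2 ⟨A₁ ++ t, P, by rw [e₁, hP, ht]; simp⟩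
    · exact (listRel_iff_s8 _ _ _).2 ⟨A₂ ++ t, Q, by rw [e₂, hQ, ht]; simp⟩
  have k12 : A₁.Disjoint B₂ := fun x hx hy =>
    d1 hx ((hm x).2 ⟨by rw [e₁]; simp [hx], by rw [e₂]; simp [hy]⟩)
  have k21 : A₂.Disjoint B₁ := fun x hx hy =>
    d2 hx ((hm x).2 ⟨by rw [e₁]; simp [hy], by rw [e₂]; simp [hx]⟩)
  rcases hA with hA | hA <;> rcases hB with hB | hB
  · exact ⟨A₂, Δ, B₂, hne, a2, hΔ, b2, d2, f2, g2,
      Or.inr (Or.inr (Or.inr ⟨e₂, by simp [e₁, hA, hB]⟩))⟩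
  · exact ⟨A₂, Δ, B₁, hne, a2, hΔ, b1, d2, k21, g1,
      Or.inr (Or.inl ⟨by simp [e₂, hB], by simp [e₁, hA]⟩)⟩
  · exact ⟨A₁, Δ, B₂, hne, a1, hΔ, b2, d1, k12, g2,
      Or.inl ⟨by simp [e₁, hB], by simp [e₂, hA]⟩⟩
  · exact ⟨A₁, Δ, B₁, hne, a1, hΔ, b1, d1, f1, g1,
      Or.inr (Or.inr (Or.inl ⟨e₁, by simp [e₂, hA, hB]⟩))⟩
end

section
/- In a D-graph, if v₁ ≺ x, v₂ ≺ x and v₁ ≠ v₂, then v₂ ≺ v₁ or v₁ ≺ v₂. -/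
namespace DGr

/-- Underlying simple graph with vertex `z` removed. -/
def H (G : DGr) (z : ℕ) : SimpleGraph ℕ where
  Adj u v := u ≠ v ∧ (u ∈ G.V ∧ v ∈ G.V) ∧ (u ≠ z ∧ v ≠ z) ∧
    ∃ a ∈ G.A, (G.W a = u ∧ G.E a = v) ∨ (G.W a = v ∧ G.E a = u)
  symm := ⟨by
    rintro u v ⟨h, ⟨h1, h2⟩, ⟨h3, h4⟩, a, ha, h5⟩
    exact ⟨h.symm, ⟨h2, h1⟩, ⟨h4, h3⟩, a, ha, h5.symm⟩⟩
  loopless := ⟨fun u h => h.1 rfl⟩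

theorem reach_of_semiwalk (G : DGr) {vs es : List ℕ} (h : G.IsSemiwalk vs es) (z u : ℕ)
    (h0 : vs[0]? = some u) (i : ℕ) : ∀ w, vs[i]? = some w →
    (∀ j ≤ i, vs[j]? ≠ some z) → (G.H z).Reachable u w := by
  obtain ⟨hl, hV, hA, hE⟩ := h
  induction i with
  | zero =>
    intro w hw _
    rw [h0] at hw
    cases hw
    exact SimpleGraph.Reachable.refl _
  | succ i ih =>
    intro w hw hz
    have hi : i + 1 < vs.length := (List.getElem?_eq_some_iff.1 hw).1
    have h1 : vs[i]? = some vs[i] := List.getElem?_eq_getElem (by omega)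
    have h2 : es[i]? = some es[i] := List.getElem?_eq_getElem (by omega)
    have h3 := ih _ h1 (fun j hj => hz j (by omega))
    by_cases hq : vs[i] = w
    · rwa [hq] at h3
    · refine h3.trans (SimpleGraph.Adj.reachable ?_)
      refine ⟨hq, ⟨hV _ (List.mem_of_getElem? h1), hV _ (List.mem_of_getElem? hw)⟩, ⟨?_, ?_⟩,
        es[i], hA _ (List.mem_of_getElem? h2), hE i _ _ _ h2 h1 hw⟩
      · intro hh
        exact hz i (by omega) (by rw [h1, hh])
      · intro hh
        exact hz (i+1) le_rfl (by rw [hw, hh])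

theorem semiwalk_of_walk (G : DGr) (z : ℕ) {u v : ℕ} (p : (G.H z).Walk u v)
    (hu : u ∈ G.V) (hz : u ≠ z) :
    (∃ es, G.IsSemiwalk p.support es) ∧ z ∉ p.support := by
  induction p with
  | nil =>
    refine ⟨⟨[], by simp, by simpa using hu, by simp, by simp⟩, by simpa using hz.symm⟩
  | @cons u w v hadj p ih =>
    obtain ⟨hne, ⟨h1, h2⟩, ⟨h3, h4⟩, a, ha, h5⟩ := id hadj
    obtain ⟨⟨es, hl, hV, hA, hE⟩, hzp⟩ := ih h2 h4
    refine ⟨⟨a :: es, by rw [SimpleGraph.Walk.support_cons, List.length_cons, List.length_cons, hl], ?_, ?_, ?_⟩, ?_⟩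
    · intro y hy
      rw [SimpleGraph.Walk.support_cons, List.mem_cons] at hy
      rcases hy with rfl | hy
      · exact h1
      · exact hV y hy
    · intro y hy
      rcases List.mem_cons.1 hy with rfl | hy
      · exact ha
      · exact hA y hy
    · intro i b s t hb hs ht
      rw [SimpleGraph.Walk.support_cons] at hs ht
      cases i with
      | zero =>
        rw [← SimpleGraph.Walk.cons_tail_support] at ht
        simp at hb hs ht
        subst hb hs ht
        exact h5
      | succ i =>
        simp only [List.getElem?_cons_succ] at hb hs ht
        exact hE i b s t hb hs ht
    · rw [SimpleGraph.Walk.support_cons, List.mem_cons]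
      rintro (h | h)
      · exact hz h.symm
      · exact hzp h

theorem not_reach (G : DGr) {z x t : ℕ} (hx : x ∈ G.V) (h : G.Pivot z x)
    (ht : G.XVertex true t) : ¬ (G.H z).Reachable x t := by
  classical
  rintro ⟨p⟩
  obtain ⟨⟨es, he⟩, hz⟩ := semiwalk_of_walk G z (p.toPath : (G.H z).Walk x t) hx h.1.symm
  refine hz (h.2 t _ es ht ⟨⟨he, p.toPath.2.support_nodup⟩, ?_, ?_⟩)
  · rw [← SimpleGraph.Walk.cons_tail_support]; rfl
  · rw [List.getLast?_eq_getLast_of_ne_nil (SimpleGraph.Walk.support_ne_nil _),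
      SimpleGraph.Walk.getLast_support]

theorem exists_of_not_pivot (G : DGr) {z v : ℕ} (hne : z ≠ v) (h : ¬ G.Pivot z v) :
    ∃ t, G.XVertex true t ∧ (G.H z).Reachable v t := by
  simp only [Pivot, not_and, not_forall] at h
  obtain ⟨t, vs, es, ht, ⟨hw, h0, h1⟩, hz⟩ := h hne
  refine ⟨t, ht, reach_of_semiwalk G hw.1 z v (by rw [← List.head?_eq_getElem?, h0])
    (vs.length - 1) t (by rw [← List.getLast?_eq_getElem?, h1]) ?_⟩
  intro j _ hj
  exact hz (List.mem_of_getElem? hj)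

end DGr

/-- **Lemma 3.2.1**: in a D-graph, if `v₁ ≺ x`, `v₂ ≺ x` and `v₁ ≠ v₂`, then
`v₂ ≺ v₁` or `v₁ ≺ v₂`. -/
theorem pivots_linearly_ordered (G : DGr) (hG : G.IsDGraph)
    (x v₁ v₂ : ℕ) (hxV : x ∈ G.V) (hv₁V : v₁ ∈ G.V) (hv₂V : v₂ ∈ G.V)
    (h1 : G.Pivot v₁ x) (h2 : G.Pivot v₂ x) (hne : v₁ ≠ v₂) :
    G.Pivot v₂ v₁ ∨ G.Pivot v₁ v₂ := by
  by_contra hc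
  rw [not_or] at hc
  obtain ⟨t1, ht1, r1⟩ := G.exists_of_not_pivot hne.symm hc.1
  obtain ⟨t2, ht2, r2⟩ := G.exists_of_not_pivot hne hc.2
  obtain ⟨vs, es, ⟨hw, hnd⟩, h0, hl⟩ := hG.2.2.2.1 x hxV v₁ hv₁V h1.1.symm
  rw [List.head?_eq_getElem?] at h0
  rw [List.getLast?_eq_getElem?] at hl
  by_cases hm : v₂ ∈ vs
  · obtain ⟨i, hi⟩ := List.mem_iff_getElem?.1 hm
    refine G.not_reach hxV h1 ht2 ((G.reach_of_semiwalk hw v₁ x h0 i v₂ hi ?_).trans r2)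
    intro j hj hj1
    have hjl : j < vs.length := (List.getElem?_eq_some_iff.1 hj1).1
    have hil : i < vs.length := (List.getElem?_eq_some_iff.1 hi).1
    have hje : j = vs.length - 1 := (List.nodup_iff_getElem?_ne_getElem?.1 hnd |> fun H => by
      by_contra hn
      exact H j (vs.length - 1) (by omega) (by omega) (by rw [hj1, hl]))
    have : i = j := by omega
    subst this
    rw [hi] at hj1
    exact hne (Option.some.inj hj1).symm
  · refine G.not_reach hxV h2 ht1 ((G.reach_of_semiwalk hw v₂ x h0 _ v₁ hl ?_).trans r1)
    intro j _ hj
    exact hm (List.mem_of_getElem? hj)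
end

section
/- In a D-graph, if v₂ ≺_∃ v₁ and v₁ ≺ x, then v₁ ▷ [x, v₂]. -/
namespace DGr

theorem aux_tail (G : DGr) (u : ℕ) (vs : List ℕ) (a : ℕ) (es : List ℕ)
    (h : G.IsSemiwalk (u :: vs) (a :: es)) : G.IsSemiwalk vs es := by
  obtain ⟨h1, h2, h3, h4⟩ := h
  refine ⟨by simpa using h1, fun v hv => h2 v (by simp [hv]), fun v hv => h3 v (by simp [hv]), ?_⟩
  intro i b p q hb hp hq
  exact h4 (i + 1) b p q (by simpa using hb) (by simpa using hp) (by simpa using hq)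

theorem aux_suffix (G : DGr) (w t : ℕ) : ∀ (vs es : List ℕ) (u : ℕ),
    G.SemipathFT u t vs es → w ∈ vs →
    ∃ vs' es', G.SemipathFT w t vs' es' ∧ (∀ z ∈ vs', z ∈ vs) ∧ (w ≠ u → u ∉ vs') := by
  intro vs
  induction vs with
  | nil => intro es u _ hw; simp at hw
  | cons p vs ih =>
    intro es u h hw
    obtain ⟨⟨hs, hn⟩, hh, hl⟩ := h
    have hpu : p = u := by simpa using hh
    subst hpu
    by_cases hwp : w = p
    · subst hwp
      exact ⟨_, es, ⟨⟨hs, hn⟩, hh, hl⟩, fun z hz => hz, fun h => absurd rfl h⟩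
    · have hw' : w ∈ vs := by simpa [hwp] using hw
      cases vs with
      | nil => simp at hw'
      | cons q vs =>
        cases es with
        | nil => have := hs.1; simp at this
        | cons a es =>
          obtain ⟨vs', es', hA, hB, -⟩ := ih es q
            ⟨⟨aux_tail G _ _ _ _ hs, (List.nodup_cons.1 hn).2⟩, by simp, by simpa using hl⟩ hw'
          exact ⟨vs', es', hA, fun z hz => List.mem_cons_of_mem _ (hB z hz),
            fun _ hp => (List.nodup_cons.1 hn).1 (hB _ hp)⟩

theorem aux_cat (G : DGr) (v t : ℕ) (qs fs : List ℕ) (hq : G.SemipathFT v t qs fs) :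
    ∀ (vs es : List ℕ) (u : ℕ), G.IsSemiwalk vs es → vs.head? = some u → vs.getLast? = some v →
    ∃ vs' es', G.SemipathFT u t vs' es' ∧ (∀ z ∈ vs', z ∈ vs ∨ z ∈ qs) := by
  intro vs
  induction vs with
  | nil => intro es u _ h; simp at h
  | cons p vs ih =>
    intro es u hs hh hl
    have hpu : p = u := by simpa using hh
    subst hpu
    cases vs with
    | nil =>
      have : p = v := by simpa using hl
      subst this
      exact ⟨qs, fs, hq, fun z hz => Or.inr hz⟩
    | cons q vs =>
      cases es with
      | nil => have := hs.1; simp at this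
      | cons a es =>
        obtain ⟨vs', es', hA, hB⟩ := ih es q (aux_tail G _ _ _ _ hs) (by simp) (by simpa using hl)
        by_cases hp : p ∈ vs'
        · obtain ⟨vs2, es2, hC, hD, -⟩ := aux_suffix G p t vs' es' q hA hp
          exact ⟨vs2, es2, hC, fun z hz => (hB z (hD z hz)).imp (List.mem_cons_of_mem _) id⟩
        · refine ⟨p :: vs', a :: es', ⟨⟨⟨?_, ?_, ?_, ?_⟩, List.nodup_cons.2 ⟨hp, hA.1.2⟩⟩, by simp, ?_⟩, ?_⟩
          · simpa using hA.1.1.1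
          · intro z hz
            rcases List.mem_cons.1 hz with rfl | hz
            · exact hs.2.1 _ (by simp)
            · exact hA.1.1.2.1 _ hz
          · intro z hz
            rcases List.mem_cons.1 hz with rfl | hz
            · exact hs.2.2.1 _ (by simp)
            · exact hA.1.1.2.2.1 _ hz
          · intro i b r s hb hr hs'
            cases i with
            | zero =>
              have h0 := hA.2.1
              rw [List.head?_eq_getElem?] at h0
              have : s = q := by
                have h5 : vs'[0]? = some s := by simpa using hs'
                rw [h0] at h5; simpa using h5.symm
              subst this
              exact hs.2.2.2 0 b r s (by simpa using hb) (by simpa using hr) (by simp)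
            | succ i =>
              exact hA.1.1.2.2.2 i b r s (by simpa using hb) (by simpa using hr) (by simpa using hs')
          · have := hA.2.2
            rw [List.getLast?_cons, this]; rfl
          · intro z hz
            rcases List.mem_cons.1 hz with rfl | hz
            · left; simp
            · exact (hB z hz).imp (List.mem_cons_of_mem _) id

end DGr

/-- **Lemma 3.2.5**: in a D-graph, if `v₂ ≺_∃ v₁` and `v₁ ≺ x`, then
`v₁ ▷ [x, v₂]`. -/
theorem pivot_in_all_semipaths (G : DGr) (hG : G.IsDGraph)
    (x v₁ v₂ : ℕ) (hxV : x ∈ G.V) (hv₁V : v₁ ∈ G.V) (hv₂V : v₂ ∈ G.V)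
    (h1 : G.PivotE v₂ v₁) (h2 : G.Pivot v₁ x) :
    G.inAll v₁ x v₂ := by
  intro vs es hp
  obtain ⟨hne, t, qs, fs, ht, hq, hm⟩ := h1
  obtain ⟨qs', fs', hA, -, hC⟩ := DGr.aux_suffix G v₂ t qs fs v₁ hq hm
  obtain ⟨rs, gs, hR, hS⟩ := DGr.aux_cat G v₂ t qs' fs' hA vs es x hp.1.1 hp.2.1 hp.2.2
  exact (hS _ (h2.2 t rs gs ht hR)).resolve_right (hC hne)
end

section
/- Let x, z, y₁,…,yₙ and v₁,…,vₙ be vertices of a D-graph, n ≥ 1, and for j, i ∈ {1,…,n} let (yji) denote the condition: vⱼ ▷ [z,x] and vⱼ ▷ [z,yᵢ] and vⱼ ≺ x and vⱼ ≺ yᵢ. If (yii) holds for every i ∈ {1,…,n}, then there is a j ∈ {1,…,n} such that (yji) holds for every i ∈ {1,…,n}. -/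
namespace DGr

def Ad (G : DGr) (p q : ℕ) : Prop :=
  ∃ e ∈ G.A, (G.W e = p ∧ G.E e = q) ∨ (G.W e = q ∧ G.E e = p)

def Cn (G : DGr) (r a b : ℕ) : Prop :=
  a ≠ r ∧ Relation.ReflTransGen (fun p q => G.Ad p q ∧ p ≠ r ∧ q ≠ r) a b

theorem Ad.symm {G : DGr} {p q : ℕ} (h : G.Ad p q) : G.Ad q p := by
  obtain ⟨e, he, h⟩ := h
  exact ⟨e, he, h.symm⟩

theorem Cn.ne_right {G : DGr} {r a b : ℕ} (h : G.Cn r a b) : b ≠ r := by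
  obtain ⟨h1, h2⟩ := h
  induction h2 with
  | refl => exact h1
  | tail _ h _ => exact h.2.2

theorem Cn.symm {G : DGr} {r a b : ℕ} (h : G.Cn r a b) : G.Cn r b a := by
  refine ⟨h.ne_right, ?_⟩
  obtain ⟨h1, h2⟩ := h
  induction h2 with
  | refl => exact .refl
  | tail _ h ih => exact .head ⟨h.1.symm, h.2.2, h.2.1⟩ ih

theorem Cn.trans {G : DGr} {r a b c : ℕ} (h : G.Cn r a b) (h' : G.Cn r b c) : G.Cn r a c :=
  ⟨h.1, h.2.trans h'.2⟩

theorem Cn.cons {G : DGr} {r a b c : ℕ} (har : a ≠ r) (h : G.Ad a b) (h' : G.Cn r b c) :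
    G.Cn r a c :=
  ⟨har, .head ⟨h, har, h'.1⟩ h'.2⟩

theorem Cn.rfl' {G : DGr} {r a : ℕ} (h : a ≠ r) : G.Cn r a a := ⟨h, .refl⟩

theorem first_hit {G : DGr} {a p q : ℕ} (hpq : p ≠ q)
    (h : Relation.ReflTransGen G.Ad a p) : G.Cn q a p ∨ G.Cn p a q := by
  induction h using Relation.ReflTransGen.head_induction_on with
  | refl => exact .inl (Cn.rfl' hpq)
  | @head a c hac _ ih =>
    by_cases h1 : a = p
    · subst h1; exact .inl (Cn.rfl' hpq)
    by_cases h2 : a = q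
    · subst h2; exact .inr (Cn.rfl' hpq.symm)
    rcases ih with ih | ih
    · exact .inl (Cn.cons h2 hac ih)
    · exact .inr (Cn.cons h1 hac ih)

theorem through {G : DGr} {r q a t : ℕ} (h : G.Cn r a t) : G.Cn q a t ∨ G.Cn r q t := by
  obtain ⟨h1, h⟩ := h
  induction h using Relation.ReflTransGen.head_induction_on with
  | refl =>
    by_cases h2 : t = q
    · subst h2; exact .inr (Cn.rfl' h1)
    · exact .inl (Cn.rfl' h2)
  | @head a c hac hct ih =>
    rcases ih hac.2.2 with ih | ih
    · by_cases h2 : a = q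
      · subst h2; exact .inr ⟨h1, .head hac hct⟩
      · exact .inl (Cn.cons h2 hac.1 ih)
    · exact .inr ih

theorem semi_reach {G : DGr} {b : ℕ} (vs : List ℕ) : ∀ (es : List ℕ) (a : ℕ),
    G.IsSemiwalk vs es → vs.head? = some a → vs.getLast? = some b →
    Relation.ReflTransGen (fun p q => G.Ad p q ∧ p ∈ vs ∧ q ∈ vs) a b := by
  induction vs with
  | nil => intro es a _ h; simp at h
  | cons u vs ih =>
    intro es a hw ha hb
    simp only [List.head?_cons, Option.some.injEq] at ha
    subst ha
    obtain ⟨hl, hV, hA, hc⟩ := hw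
    cases vs with
    | nil =>
      simp at hb; subst hb; exact .refl
    | cons c vs =>
      cases es with
      | nil => simp at hl
      | cons e es =>
        have h0 := hc 0 e u c (by simp) (by simp) (by simp)
        have := ih es c ⟨by simpa using hl, fun v hv => hV v (List.mem_cons_of_mem _ hv),
          fun v hv => hA v (List.mem_cons_of_mem _ hv),
          fun i a u v h1 h2 h3 => hc (i+1) a u v (by simpa using h1) (by simpa using h2)
            (by simpa using h3)⟩ (by simp) (by simpa using hb)
        refine .head ⟨⟨e, hA e (by simp), h0⟩, by simp, by simp⟩ ?_
        exact Relation.ReflTransGen.mono (fun p q h =>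
          ⟨h.1, List.mem_cons_of_mem _ h.2.1, List.mem_cons_of_mem _ h.2.2⟩) _ _ this

theorem suffix_path {G : DGr} {a b c : ℕ} {vs es : List ℕ} (h : G.SemipathFT c b vs es)
    (ha : a ∈ vs) : ∃ vs' es', G.SemipathFT a b vs' es' ∧ ∀ w ∈ vs', w ∈ vs := by
  obtain ⟨i, hi, rfl⟩ := List.mem_iff_getElem.1 ha
  obtain ⟨⟨⟨hl, hV, hA, hc⟩, hn⟩, hh, hb⟩ := h
  refine ⟨vs.drop i, es.drop i, ⟨⟨⟨?_, ?_, ?_, ?_⟩, ?_⟩, ?_, ?_⟩, ?_⟩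
  · simp; omega
  · exact fun v hv => hV v (List.mem_of_mem_drop hv)
  · exact fun v hv => hA v (List.mem_of_mem_drop hv)
  · intro j a u v h1 h2 h3
    rw [List.getElem?_drop] at h1 h2 h3
    exact hc (i+j) a u v h1 h2 h3
  · exact hn.sublist (List.drop_sublist _ _)
  · simp [List.head?_drop, hi]
  · rw [List.getLast?_drop, if_neg (by omega), hb]
  · exact fun w hw => List.mem_of_mem_drop hw

theorem cn_path {G : DGr} (hG : G.WellFormed) {r a b : ℕ} (haV : a ∈ G.V) (h : G.Cn r a b) :
    ∃ vs es, G.SemipathFT a b vs es ∧ r ∉ vs := by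
  obtain ⟨h1, h⟩ := h
  induction h using Relation.ReflTransGen.head_induction_on with
  | refl =>
    refine ⟨[b], [], ⟨⟨⟨by simp, by simpa using haV, by simp, by simp⟩, by simp⟩, by simp, by simp⟩, ?_⟩
    simpa using h1.symm
  | @head a c hac hct ih =>
    obtain ⟨⟨e, he, hec⟩, -, hcr⟩ := hac
    have hcV : c ∈ G.V := by
      rcases hec with ⟨_, h⟩ | ⟨h, _⟩
      · exact h ▸ (hG e he).2
      · exact h ▸ (hG e he).1
    obtain ⟨vs, es, hp, hr⟩ := ih hcV hcr
    by_cases hav : a ∈ vs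
    · obtain ⟨vs', es', hp', hs⟩ := suffix_path hp hav
      exact ⟨vs', es', hp', fun h => hr (hs _ h)⟩
    · obtain ⟨⟨⟨hl, hV, hA, hc⟩, hn⟩, hh, hb⟩ := hp
      refine ⟨a :: vs, e :: es, ⟨⟨⟨?_, ?_, ?_, ?_⟩, ?_⟩, ?_, ?_⟩, ?_⟩
      · simp [hl]
      · intro v hv
        rcases List.mem_cons.1 hv with rfl | hv
        · exact haV
        · exact hV v hv
      · intro v hv
        rcases List.mem_cons.1 hv with rfl | hv
        · exact he
        · exact hA v hv
      · intro i a' u v g1 g2 g3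
        cases i with
        | zero =>
          simp at g1 g2 g3
          rw [List.head?_eq_getElem?] at hh
          rw [hh] at g3
          simp at g3
          subst g1 g2 g3
          exact hec
        | succ i =>
          exact hc i a' u v (by simpa using g1) (by simpa using g2) (by simpa using g3)
      · exact List.nodup_cons.2 ⟨hav, hn⟩
      · simp
      · rw [List.getLast?_cons, hb]; rfl
      · simp only [List.mem_cons, not_or]
        exact ⟨h1.symm, hr⟩

theorem inAll_iff {G : DGr} (hG : G.WellFormed) {r a b : ℕ} (haV : a ∈ G.V) :
    G.inAll r a b ↔ ¬ G.Cn r a b := by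
  constructor
  · intro h hc
    obtain ⟨vs, es, hp, hr⟩ := cn_path hG haV hc
    exact hr (h _ _ hp)
  · intro h vs es hp
    by_contra hr
    refine h ⟨?_, ?_⟩
    · rintro rfl
      exact hr (List.mem_of_mem_head? (by rw [hp.2.1]; rfl))
    · exact Relation.ReflTransGen.mono (fun p q h =>
        ⟨h.1, fun e => hr (e ▸ h.2.1), fun e => hr (e ▸ h.2.2)⟩) _ _ (semi_reach vs es a hp.1.1 hp.2.1 hp.2.2)

theorem pivot_iff {G : DGr} (hG : G.WellFormed) {r a : ℕ} (haV : a ∈ G.V) :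
    G.Pivot r a ↔ r ≠ a ∧ ∀ t, G.XVertex true t → ¬ G.Cn r a t := by
  unfold Pivot
  refine and_congr Iff.rfl ⟨fun h t ht => (inAll_iff hG haV).1 fun vs es => h t vs es ht,
    fun h t vs es ht => (inAll_iff hG haV).2 (h t ht) vs es⟩

theorem reach {G : DGr} (hG : G.WeaklyConnected) {a b : ℕ} (ha : a ∈ G.V) (hb : b ∈ G.V) :
    Relation.ReflTransGen G.Ad a b := by
  by_cases h : a = b
  · subst h; exact .refl
  obtain ⟨vs, es, hp⟩ := hG a ha b hb h
  exact Relation.ReflTransGen.mono (fun p q h => h.1) _ _ (semi_reach vs es a hp.1.1 hp.2.1 hp.2.2)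

theorem exists_W {G : DGr} (hG : G.WellFormed) (hac : G.Acyclic) {x : ℕ} (hx : x ∈ G.V) :
    ∃ t, G.XVertex true t := by
  by_contra! hno
  have hpred : ∀ u ∈ G.V, ∃ a ∈ G.A, G.E a = u := by
    intro u hu
    by_contra! h
    exact hno u ⟨hu, fun a ha => by simpa [Xf] using h a ha⟩
  have key : ∀ n : ℕ, ∃ vs es, G.IsWalk vs es ∧ vs.Nodup ∧ es.length = n := by
    intro n
    induction n with
    | zero => exact ⟨[x], [], ⟨by simp, by simpa using hx, by simp, by simp⟩, by simp, rfl⟩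
    | succ n ih =>
      obtain ⟨vs, es, ⟨hl, hV, hA, hc⟩, hn, hes⟩ := ih
      cases vs with
      | nil => simp at hl
      | cons u vs =>
      obtain ⟨e, he, heu⟩ := hpred u (hV u (by simp))
      have hwalk : G.IsWalk (G.W e :: u :: vs) (e :: es) := by
        refine ⟨by simpa using hl, ?_, ?_, ?_⟩
        · intro v hv
          rcases List.mem_cons.1 hv with rfl | hv
          · exact (hG e he).1
          · exact hV v hv
        · intro v hv
          rcases List.mem_cons.1 hv with rfl | hv
          · exact he
          · exact hA v hv
        · intro i a' p q g1 g2 g3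
          cases i with
          | zero =>
            simp at g1 g2 g3
            subst g1 g2 g3
            exact ⟨rfl, heu⟩
          | succ i =>
            exact hc i a' p q (by simpa using g1) (by simpa using g2) (by simpa using g3)
      by_cases hw : G.W e ∈ u :: vs
      · exfalso
        obtain ⟨i, hi, hiw⟩ := List.mem_iff_getElem.1 hw
        generalize hL : u :: vs = L at *
        obtain ⟨hl', hV', hA', hc'⟩ := hwalk
        refine hac (G.W e :: L.take (i+1)) (e :: es.take i) ⟨⟨?_, ?_, ?_, ?_⟩, by simp, ?_, ?_⟩
        · simp; omega
        · intro v hv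
          rcases List.mem_cons.1 hv with rfl | hv
          · exact (hG e he).1
          · exact hV v (List.mem_of_mem_take hv)
        · intro v hv
          rcases List.mem_cons.1 hv with rfl | hv
          · exact he
          · exact hA v (List.mem_of_mem_take hv)
        · intro j a' p q g1 g2 g3
          rw [← List.take_succ_cons] at g1 g2 g3
          rw [List.getElem?_take] at g1 g2 g3
          split_ifs at g1 g2 g3
          exact hc' j a' p q g1 g2 g3
        · rw [List.getLast?_cons, List.getLast?_take]
          simp [hi, hiw]
        · have : (G.W e :: L.take (i+1)).dropLast = G.W e :: L.take i := by
            rw [List.take_succ_eq_append_getElem hi, ← List.cons_append, List.dropLast_concat]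
          rw [this]
          refine List.nodup_cons.2 ⟨?_, hn.sublist (List.take_sublist _ _)⟩
          intro hm
          obtain ⟨k, hk, hkw⟩ := List.mem_take_iff_getElem.1 hm
          have := (hn.getElem_inj_iff (hi := by omega) (hj := hi)).1 (hkw.trans hiw.symm)
          omega
      · exact ⟨_, _, hwalk, List.nodup_cons.2 ⟨hw, hn⟩, by simpa using hes⟩
  obtain ⟨vs, es, ⟨hl, hV, -, -⟩, hn, hes⟩ := key G.V.card
  have h1 := List.toFinset_card_of_nodup hn
  have h2 : vs.toFinset.card ≤ G.V.card :=
    Finset.card_le_card fun v hv => hV v (List.mem_toFinset.1 hv)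
  omega

theorem pivot_asymm {G : DGr} (hG : G.IsDGraph) {p q : ℕ} (hp : p ∈ G.V) (hq : q ∈ G.V)
    (h : G.Pivot p q) (h' : G.Pivot q p) : False := by
  obtain ⟨hwf, hac, -, hwc, -⟩ := hG
  obtain ⟨t, ht⟩ := exists_W hwf hac hp
  rw [pivot_iff hwf hq] at h
  rw [pivot_iff hwf hp] at h'
  rcases first_hit h.1 (reach hwc ht.1 hp) with h1 | h1
  · exact h'.2 t ht h1.symm
  · exact h.2 t ht h1.symm

theorem pivot_trans {G : DGr} (hG : G.IsDGraph) {r q y : ℕ} (hr : r ∈ G.V) (hq : q ∈ G.V)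
    (hy : y ∈ G.V) (h : G.Pivot r q) (h' : G.Pivot q y) : G.Pivot r y := by
  have hne : r ≠ y := by
    rintro rfl
    exact pivot_asymm hG hr hq h h'
  have hwf := hG.1
  rw [pivot_iff hwf hq] at h
  rw [pivot_iff hwf hy] at h' ⊢
  refine ⟨hne, fun t ht hc => ?_⟩
  rcases through (q := q) hc with h1 | h1
  · exact h'.2 t ht h1
  · exact h.2 t ht h1

theorem pivot_of_cn {G : DGr} (hG : G.WellFormed) {q r x : ℕ} (hx : x ∈ G.V) (hr : r ∈ G.V)
    (h : G.Pivot q x) (hc : G.Cn q x r) : G.Pivot q r := by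
  rw [pivot_iff hG hx] at h
  rw [pivot_iff hG hr]
  exact ⟨hc.ne_right.symm, fun t ht h1 => h.2 t ht (hc.trans h1)⟩

theorem pivot_total {G : DGr} (hG : G.IsDGraph) {p q x : ℕ} (hp : p ∈ G.V) (hq : q ∈ G.V)
    (hx : x ∈ G.V) (h : G.Pivot p x) (h' : G.Pivot q x) :
    p = q ∨ G.Pivot p q ∨ G.Pivot q p := by
  by_cases hpq : p = q
  · exact .inl hpq
  rcases first_hit hpq (reach hG.2.2.2.1 hx hp) with h1 | h1
  · exact .inr (.inr (pivot_of_cn hG.1 hx hp h' h1))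
  · exact .inr (.inl (pivot_of_cn hG.1 hx hq h h1))

end DGr

/-- **Lemma 3.3.1**: if for every `i` the condition `(yii)` holds, then for some
`j` the condition `(yji)` holds for every `i`, where `(yji)` is
`vⱼ ▷ [z,x]  ∧  vⱼ ▷ [z,yᵢ]  ∧  vⱼ ≺ x  ∧  vⱼ ≺ yᵢ`. -/
theorem common_pivot_selection (G : DGr) (hG : G.IsDGraph)
    (n : ℕ) (hn : 1 ≤ n) (x z : ℕ) (y v : Fin n → ℕ)
    (hxV : x ∈ G.V) (hzV : z ∈ G.V)
    (hyV : ∀ i, y i ∈ G.V) (hvV : ∀ i, v i ∈ G.V)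
    (H : ∀ i : Fin n, G.inAll (v i) z x ∧ G.inAll (v i) z (y i) ∧
      G.Pivot (v i) x ∧ G.Pivot (v i) (y i)) :
    ∃ j : Fin n, ∀ i : Fin n, G.inAll (v j) z x ∧ G.inAll (v j) z (y i) ∧
      G.Pivot (v j) x ∧ G.Pivot (v j) (y i) := by
  have hmin : ∀ s : Finset (Fin n), s.Nonempty →
      ∃ j ∈ s, ∀ i ∈ s, v j = v i ∨ G.Pivot (v j) (v i) := by
    intro s hs
    induction hs using Finset.Nonempty.cons_induction with
    | singleton a => exact ⟨a, by simp, by simp⟩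
    | cons a s ha hs ih =>
      obtain ⟨j, hj, hji⟩ := ih
      rcases DGr.pivot_total hG (hvV j) (hvV a) hxV (H j).2.2.1 (H a).2.2.1 with h | h | h
      · refine ⟨j, by simp [hj], fun i hi => ?_⟩
        rcases Finset.mem_cons.1 hi with rfl | hi
        · exact .inl h
        · exact hji i hi
      · refine ⟨j, by simp [hj], fun i hi => ?_⟩
        rcases Finset.mem_cons.1 hi with rfl | hi
        · exact .inr h
        · exact hji i hi
      · refine ⟨a, by simp, fun i hi => ?_⟩
        rcases Finset.mem_cons.1 hi with rfl | hi
        · exact .inl rfl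
        · rcases hji i hi with h1 | h1
          · exact .inr (h1 ▸ h)
          · exact .inr (DGr.pivot_trans hG (hvV a) (hvV j) (hvV i) h h1)
  obtain ⟨j, -, hj⟩ := hmin Finset.univ ⟨⟨0, hn⟩, Finset.mem_univ _⟩
  refine ⟨j, fun i => ?_⟩
  rcases hj i (Finset.mem_univ _) with h | h
  · rw [h]; exact H i
  refine ⟨(H j).1, ?_, (H j).2.2.1, DGr.pivot_trans hG (hvV j) (hvV i) (hyV i) h (H i).2.2.2⟩
  have hzx := (DGr.inAll_iff hG.1 hzV).1 (H j).1
  have hzy := (DGr.inAll_iff hG.1 hzV).1 (H i).2.1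
  rw [DGr.inAll_iff hG.1 hzV]
  intro hc
  rcases DGr.through (q := v i) hc.symm with h1 | h1
  · exact hzy h1.symm
  rcases DGr.first_hit h.1 (DGr.reach hG.2.2.2.1 hxV (hvV j)) with h2 | h2
  · exact DGr.pivot_asymm hG (hvV j) (hvV i) h
      (DGr.pivot_of_cn hG.1 hxV (hvV j) (H i).2.2.1 h2)
  · exact hzx (h2.trans h1).symm
end

section
/- Let D be a D-graph and let v, u, w be distinct X-vertices of D, where X ∈ {W,E}. Then ψ_X(v,u,w) holds if and only if ψ_X^b(m(v), m(u), m(w)) holds. -/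
namespace DGr

theorem aux_inc (G : DGr) (hF : G.WEFunctional) (X : Bool) (x a b q : ℕ)
    (hx : G.XVertex X x) (ha : a ∈ G.A) (hax : G.Xf X a = x) (hb : b ∈ G.A)
    (h : (G.W b = x ∧ G.E b = q) ∨ (G.W b = q ∧ G.E b = x)) : q = G.Xf (!X) a := by
  have h1 := hx.2 b hb
  have h2 := hF X a ⟨ha, hax ▸ hx⟩ b hb
  by_cases hba : b = a
  · subst hba
    cases X <;> simp [Xf] at * <;> grind
  · have h3 := h2 hba
    cases X <;> simp [Xf] at * <;> grind

theorem aux_rev (G : DGr) (s t : ℕ) (vs es : List ℕ) (h : G.SemipathFT s t vs es) :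
    G.SemipathFT t s vs.reverse es.reverse := by
  obtain ⟨⟨⟨hl, hV, hA, hi⟩, hn⟩, h1, h2⟩ := h
  refine ⟨⟨⟨by simpa using hl, by simpa using hV, by simpa using hA, ?_⟩, by simpa using hn⟩,
    by simpa using h2, by simpa using h1⟩
  intro i a p q ha hp hq
  have hlt : i < es.length := by
    have := (List.getElem?_eq_some_iff.1 ha).1
    simpa using this
  rw [List.getElem?_reverse (by omega)] at ha hp hq
  have := hi (es.length - 1 - i) a q p ha
    (by rw [← hq]; congr 1; omega) (by rw [← hp]; congr 1; omega)
  tauto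

theorem aux_cons (G : DGr) (hW : G.WellFormed) (X : Bool) (t a : ℕ) (vs es : List ℕ)
    (ha : a ∈ G.A) (h : G.SemipathFT (G.Xf (!X) a) t vs es) (hn' : G.Xf X a ∉ vs) :
    G.SemipathFT (G.Xf X a) t (G.Xf X a :: vs) (a :: es) := by
  obtain ⟨⟨⟨hl, hV, hA, hi⟩, hn⟩, h1, h2⟩ := h
  have hw := hW a ha
  refine ⟨⟨⟨by simp [hl], ?_, ?_, ?_⟩, by simp [hn, hn']⟩, by simp, ?_⟩
  · intro z hz
    rcases List.mem_cons.1 hz with rfl | hz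
    · cases X <;> simp [Xf, hw]
    · exact hV z hz
  · intro z hz
    rcases List.mem_cons.1 hz with rfl | hz
    · exact ha
    · exact hA z hz
  · intro i b p q hb hp hq
    cases i with
    | zero =>
      have h3 : vs[0]? = some (G.Xf (!X) a) := by rw [← List.head?_eq_getElem?]; exact h1
      simp at hb hp hq
      subst hb
      have : q = G.Xf (!X) a := by simpa [h3] using hq.symm
      cases X <;> simp [Xf] at * <;> grind
    | succ i => exact hi i b p q (by simpa using hb) (by simpa using hp) (by simpa using hq)
  · cases vs with
    | nil => simp at h1
    | cons y l => simpa using h2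

theorem aux_tail_s16 (G : DGr) (hF : G.WEFunctional) (X : Bool) (x t a : ℕ) (vs es : List ℕ)
    (hx : G.XVertex X x) (ha : a ∈ G.A) (hax : G.Xf X a = x) (hxt : x ≠ t)
    (h : G.SemipathFT x t vs es) :
    ∃ vs' es', G.SemipathFT (G.Xf (!X) a) t vs' es' ∧ ∀ z ∈ vs', z ∈ vs := by
  obtain ⟨⟨⟨hl, hV, hA, hi⟩, hn⟩, h1, h2⟩ := h
  match vs, es with
  | [], _ => simp at h1
  | [y], _ => simp at h1 h2; omega
  | y :: y' :: l, [] => simp at hl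
  | y :: y' :: l, b :: es =>
    simp at h1
    subst h1
    have h3 := aux_inc G hF X y a b y' hx ha hax (hA b (by simp))
      (hi 0 b y y' (by simp) (by simp) (by simp))
    refine ⟨y' :: l, es, ⟨⟨⟨by simpa using hl, fun z hz => hV z (List.mem_cons_of_mem _ hz),
      fun z hz => hA z (List.mem_cons_of_mem _ hz), ?_⟩, (List.nodup_cons.1 hn).2⟩, by simp [h3],
      by simpa using h2⟩, fun z hz => List.mem_cons_of_mem _ hz⟩
    intro i c p q hc hp hq
    exact hi (i+1) c p q (by simpa using hc) (by simpa using hp) (by simpa using hq)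

theorem aux_not_mem (G : DGr) (hF : G.WEFunctional) (X : Bool) (x s t a : ℕ) (vs es : List ℕ)
    (hx : G.XVertex X x) (ha : a ∈ G.A) (hax : G.Xf X a = x) (hxs : x ≠ s) (hxt : x ≠ t)
    (h : G.SemipathFT s t vs es) : x ∉ vs := by
  obtain ⟨⟨⟨hl, hV, hA, hi⟩, hn⟩, h1, h2⟩ := h
  intro hm
  obtain ⟨i, hil, hix⟩ := List.getElem_of_mem hm
  have hi0 : i ≠ 0 := by
    rintro rfl
    rw [List.head?_eq_getElem?, List.getElem?_eq_getElem hil] at h1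
    simp at h1; omega
  have hi1 : i ≠ vs.length - 1 := by
    rintro rfl
    rw [List.getLast?_eq_getElem?, List.getElem?_eq_getElem hil] at h2
    simp at h2; omega
  obtain ⟨j, rfl⟩ := Nat.exists_eq_succ_of_ne_zero hi0
  have hj1 : j < es.length := by omega
  have hj2 : j + 1 < es.length := by omega
  have hj3 : j < vs.length := by omega
  have hj4 : j + 1 + 1 < vs.length := by omega
  have hix' : vs[j+1]? = some x := by rw [← hix]; exact List.getElem?_eq_getElem hil
  have e1 := hi j es[j] vs[j] x (List.getElem?_eq_getElem hj1) (List.getElem?_eq_getElem hj3) hix'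
  have e2 := hi (j+1) es[j+1] x vs[j+1+1] (List.getElem?_eq_getElem hj2) hix'
    (List.getElem?_eq_getElem hj4)
  have f1 := aux_inc G hF X x a es[j] vs[j] hx ha hax (hA _ (List.getElem_mem _)) e1.symm
  have f2 := aux_inc G hF X x a es[j+1] vs[j+1+1] hx ha hax (hA _ (List.getElem_mem _)) e2
  have := (hn.getElem_inj_iff (hi := hj3) (hj := hj4)).1 (f1.trans f2.symm)
  omega

end DGr

/-- **Proposition 1.9.1**: for distinct `X`-vertices `v`, `u`, `w` of a D-graph,
`ψ_X(v,u,w)` holds iff `ψ_X^b(m(v), m(u), m(w))` holds, where the mate `m(x)`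
of an `X`-vertex `x` is the `X̄`-end of the (unique) edge whose `X`-end is `x`,
and `ψ_X^b` is defined by the same intersection condition as `ψ_X`. -/
theorem psi_iff_psi_of_mates (G : DGr) (hG : G.IsDGraph) (X : Bool)
    (v u w : ℕ) (hv : G.XVertex X v) (hu : G.XVertex X u) (hw : G.XVertex X w)
    (hvu : v ≠ u) (hvw : v ≠ w) (huw : u ≠ w)
    (av au aw : ℕ)
    (hav : av ∈ G.A) (havX : G.Xf X av = v)
    (hau : au ∈ G.A) (hauX : G.Xf X au = u)
    (haw : aw ∈ G.A) (hawX : G.Xf X aw = w) :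
    G.psi X v u w ↔ G.psi X (G.Xf (!X) av) (G.Xf (!X) au) (G.Xf (!X) aw) := by
  obtain ⟨hWF, -, hF, -, -⟩ := hG
  have ne : ∀ {x b}, G.XVertex X x → b ∈ G.A → x ≠ G.Xf (!X) b :=
    fun hx hb h => hx.2 _ hb h.symm
  have net : ∀ {b t}, b ∈ G.A → G.XVertex (!X) t → G.Xf X b ≠ t := by
    intro b t hb ht
    have := ht.2 b hb
    simpa using this
  constructor
  · intro H P eP hP t Q eQ ht hQ
    have nP : ∀ {x b}, G.XVertex X x → b ∈ G.A → G.Xf X b = x → x ∉ P := fun hx hb hbx =>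
      DGr.aux_not_mem G hF X _ _ _ _ P eP hx hb hbx (ne hx hav) (ne hx haw) hP
    have nQ : ∀ {x b}, G.XVertex X x → b ∈ G.A → G.Xf X b = x → x ∉ Q := fun hx hb hbx =>
      DGr.aux_not_mem G hF X _ _ _ _ Q eQ hx hb hbx (ne hx hau) (hbx ▸ net hb ht) hQ
    have hP1 := DGr.aux_rev G _ _ _ _ (DGr.aux_cons G hWF X _ av P eP hav hP
      (havX ▸ nP hv hav havX))
    have hP2 := DGr.aux_rev G _ _ _ _ (DGr.aux_cons G hWF X _ aw _ _ haw hP1 (by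
      have := nP hw haw hawX
      simp [hawX, havX, this, hvw.symm]))
    have hQ1 := DGr.aux_cons G hWF X _ au Q eQ hau hQ (hauX ▸ nQ hu hau hauX)
    rw [havX, hawX] at hP2
    rw [hauX] at hQ1
    obtain ⟨z, hz1, hz2⟩ := H _ _ hP2 t _ _ ht hQ1
    have a1 := nP hu hau hauX
    have a2 := nQ hv hav havX
    have a3 := nQ hw haw hawX
    simp at hz1 hz2
    refine ⟨z, ?_⟩
    grind
  · intro H P eP hP t Q eQ ht hQ
    obtain ⟨P1, e1, hP1, s1⟩ := DGr.aux_tail_s16 G hF X v w av P eP hv hav havX hvw hP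
    obtain ⟨P2, e2, hP2, s2⟩ := DGr.aux_tail_s16 G hF X w _ aw _ _ hw haw hawX (ne hw hav)
      (DGr.aux_rev G _ _ _ _ hP1)
    obtain ⟨Q1, f1, hQ1, s3⟩ := DGr.aux_tail_s16 G hF X u t au Q eQ hu hau hauX
      (hauX ▸ net hau ht) hQ
    obtain ⟨z, hz1, hz2⟩ := H _ _ (DGr.aux_rev G _ _ _ _ hP2) t _ _ ht hQ1
    exact ⟨z, s1 z (by simpa using s2 z (by simpa using hz1)), s3 z hz2⟩
end

section
/- Let x, x′, y be distinct E-vertices of a D-graph and let v be a vertex. If v ≺ x, v ≺ x′, v ▷ [x,y] and not v ▷ [x,x′], then ψ_E(x,y,x′) does not hold. -/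
namespace DGr

/-- One step of a semiwalk along `a`. -/
def SStep (G : DGr) (a u w : ℕ) : Prop :=
  a ∈ G.A ∧ ((G.W a = u ∧ G.E a = w) ∨ (G.W a = w ∧ G.E a = u))

/-- One step of a walk along `a`. -/
def WStep (G : DGr) (a u w : ℕ) : Prop :=
  a ∈ G.A ∧ (G.W a = u ∧ G.E a = w)

/-- Simple chains for a labelled step relation inside `S`. -/
inductive PathIn (st : ℕ → ℕ → ℕ → Prop) (S : ℕ → Prop) : List ℕ → List ℕ → Prop
  | nil (u : ℕ) : S u → PathIn st S [u] []
  | cons (a u u' : ℕ) (vs es : List ℕ) : S u → st a u u' → PathIn st S (u' :: vs) es →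
      u ∉ u' :: vs → PathIn st S (u :: u' :: vs) (a :: es)

/-- Adjacency inside `S`. -/
def RIn (st : ℕ → ℕ → ℕ → Prop) (S : ℕ → Prop) (u w : ℕ) : Prop :=
  S u ∧ S w ∧ ∃ a, st a u w

theorem PathIn.suffix {st S vs es} (h : PathIn st S vs es) (u : ℕ) (hu : u ∈ vs) :
    ∃ vs' es', PathIn st S (u :: vs') es' ∧ (u :: vs').getLast? = vs.getLast? := by
  induction h with
  | nil w hw =>
    simp at hu; subst hu
    exact ⟨[], [], PathIn.nil _ hw, rfl⟩
  | cons a w w' vs es hw hst hp hn ih =>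
    by_cases h : u = w
    · subst h
      exact ⟨_, _, PathIn.cons a u w' vs es hw hst hp hn, rfl⟩
    · have : u ∈ w' :: vs := by
        rcases List.mem_cons.1 hu with h' | h'
        · exact absurd h' h
        · exact h'
      obtain ⟨vs', es', h1, h2⟩ := ih this
      exact ⟨vs', es', h1, by rw [h2]; simp⟩

theorem PathIn.of_reach {st S} {u w : ℕ} (hw : S w)
    (h : Relation.ReflTransGen (RIn st S) u w) :
    ∃ vs es, PathIn st S (u :: vs) es ∧ (u :: vs).getLast? = some w := by
  induction h using Relation.ReflTransGen.head_induction_on with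
  | refl => exact ⟨[], [], PathIn.nil _ hw, rfl⟩
  | head h1 h0 ih =>
    rename_i a c
    obtain ⟨vs, es, h2, h3⟩ := ih
    obtain ⟨hSa, hSc, e, he⟩ := h1
    by_cases hm : a ∈ c :: vs
    · obtain ⟨vs', es', h4, h5⟩ := h2.suffix a hm
      exact ⟨vs', es', h4, h5.trans h3⟩
    · exact ⟨_, _, PathIn.cons e a c vs es hSa he h2 hm, by simpa using h3⟩

theorem PathIn.props {st S vs es} (h : PathIn st S vs es) :
    vs.Nodup ∧ vs.length = es.length + 1 ∧ (∀ z ∈ vs, S z) ∧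
    (∀ (i a u v : ℕ), es[i]? = some a → vs[i]? = some u → vs[i + 1]? = some v → st a u v) ∧
    (∀ a ∈ es, ∃ u v, st a u v) := by
  induction h with
  | nil w hw => simp [hw]
  | cons a w w' vs es hw hst hp hn ih =>
    obtain ⟨i1, i2, i3, i4, i5⟩ := ih
    refine ⟨List.nodup_cons.2 ⟨hn, i1⟩, by simp at i2 ⊢; omega, ?_, ?_, ?_⟩
    · intro z hz
      rcases List.mem_cons.1 hz with rfl | h'
      · exact hw
      · exact i3 z h'
    · intro i b u v h1 h2 h3
      cases i with
      | zero => simp at h1 h2 h3; subst h1 h2 h3; exact hst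
      | succ i => exact i4 i b u v (by simpa using h1) (by simpa using h2) (by simpa using h3)
    · intro b hb
      rcases List.mem_cons.1 hb with rfl | h'
      · exact ⟨_, _, hst⟩
      · exact i5 b h'

theorem semipath_of_reach (G : DGr) {S : ℕ → Prop} (hS : ∀ z, S z → z ∈ G.V) {u w : ℕ}
    (hw : S w) (h : Relation.ReflTransGen (RIn G.SStep S) u w) :
    ∃ vs es, G.SemipathFT u w vs es ∧ ∀ z ∈ vs, S z := by
  obtain ⟨vs, es, h1, h2⟩ := PathIn.of_reach hw h
  obtain ⟨p1, p2, p3, p4, p5⟩ := h1.props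
  refine ⟨u :: vs, es, ⟨⟨⟨p2, fun z hz => hS z (p3 z hz), ?_, ?_⟩, p1⟩, rfl, h2⟩, p3⟩
  · intro a ha
    obtain ⟨_, _, h⟩ := p5 a ha
    exact h.1
  · intro i a u v h1 h2 h3
    exact (p4 i a u v h1 h2 h3).2

theorem reach_of_semiwalk_s17 (G : DGr) {S : ℕ → Prop} (vs : List ℕ) :
    ∀ (u : ℕ) (es : List ℕ), G.IsSemiwalk (u :: vs) es → (∀ z ∈ u :: vs, S z) →
    ∀ z ∈ u :: vs, Relation.ReflTransGen (RIn G.SStep S) u z := by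
  induction vs with
  | nil =>
    intro u es _ _ z hz
    simp at hz; subst hz; exact .refl
  | cons u' vs ih =>
    intro u es h hS z hz
    obtain ⟨l, hV, hA, hst⟩ := h
    cases es with
    | nil => simp at l
    | cons a es =>
      rcases List.mem_cons.1 hz with rfl | hz
      · exact .refl
      · refine .head ⟨hS u (by simp), hS u' (by simp), a, hA a (by simp),
          hst 0 a u u' rfl rfl rfl⟩ (ih u' es ⟨by simpa using l, ?_, ?_, ?_⟩ ?_ z hz)
        · intro v hv; exact hV v (List.mem_cons_of_mem _ hv)
        · intro v hv; exact hA v (List.mem_cons_of_mem _ hv)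
        · intro i b p q h1 h2 h3
          exact hst (i+1) b p q (by simpa using h1) (by simpa using h2) (by simpa using h3)
        · intro v hv; exact hS v (List.mem_cons_of_mem _ hv)

theorem reach_of_semipath (G : DGr) {S : ℕ → Prop} {u w : ℕ} {vs es : List ℕ}
    (h : G.SemipathFT u w vs es) (hS : ∀ z ∈ vs, S z) :
    ∀ z ∈ vs, Relation.ReflTransGen (RIn G.SStep S) u z := by
  obtain ⟨⟨h1, _⟩, h2, _⟩ := h
  cases vs with
  | nil => simp at h2
  | cons a vs =>
    simp at h2; subst h2
    exact reach_of_semiwalk_s17 G vs a es h1 hS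

theorem no_closed (G : DGr) (hac : G.Acyclic) (z : ℕ) :
    ¬ Relation.TransGen (RIn G.WStep (· ∈ G.V)) z z := by
  intro h
  obtain ⟨w, ⟨hz, hw, a, ha⟩, hr⟩ := Relation.TransGen.head'_iff.1 h
  obtain ⟨vs, es, h1, h2⟩ := PathIn.of_reach hz hr
  obtain ⟨p1, p2, p3, p4, p5⟩ := h1.props
  refine hac (z :: w :: vs) (a :: es) ⟨⟨by simp at p2 ⊢; omega, ?_, ?_, ?_⟩, by simp, ?_, ?_⟩
  · intro v hv
    rcases List.mem_cons.1 hv with rfl | hv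
    · exact hz
    · exact p3 v hv
  · intro b hb
    rcases List.mem_cons.1 hb with rfl | hb
    · exact ha.1
    · obtain ⟨_, _, h⟩ := p5 b hb
      exact h.1
  · intro i b u v q1 q2 q3
    cases i with
    | zero => simp at q1 q2 q3; subst q1 q2 q3; exact ha.2
    | succ i => exact (p4 i b u v (by simpa using q1) (by simpa using q2) (by simpa using q3)).2
  · rw [List.getLast?_cons_cons, h2]; rfl
  · rw [List.dropLast_cons_of_ne_nil (by simp)]
    have e := List.dropLast_append_getLast? z (by rw [h2]; rfl)
    rw [← e] at p1
    rw [List.nodup_append] at p1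
    obtain ⟨n1, _, n3⟩ := p1
    refine List.nodup_cons.2 ⟨fun hm => n3 z hm z (by simp) rfl, n1⟩

/-- From every vertex one can go west to a W-vertex. -/
theorem exists_west (G : DGr) (hwf : G.WellFormed) (hac : G.Acyclic) (z : ℕ) (hz : z ∈ G.V) :
    ∃ t, G.XVertex true t ∧ Relation.ReflTransGen (RIn G.WStep (· ∈ G.V)) t z := by
  have key : ∀ z : {z // z ∈ G.V}, ∃ t, G.XVertex true t ∧
      Relation.ReflTransGen (RIn G.WStep (· ∈ G.V)) t z.1 := by
    let r : {z // z ∈ G.V} → {z // z ∈ G.V} → Prop :=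
      fun p q => Relation.TransGen (RIn G.WStep (· ∈ G.V)) p.1 q.1
    haveI : IsTrans _ r := ⟨fun _ _ _ h1 h2 => Relation.TransGen.trans h1 h2⟩
    haveI : Std.Irrefl r := ⟨fun p h => no_closed G hac p.1 h⟩
    have wf : WellFounded r := Finite.wellFounded_of_trans_of_irrefl r
    intro z
    induction z using wf.induction with
    | _ z ih =>
      by_cases h : G.XVertex true z.1
      · exact ⟨z.1, h, .refl⟩
      · have : ∃ a ∈ G.A, G.E a = z.1 := by
          by_contra hc
          push Not at hc
          exact h ⟨z.2, fun a ha => hc a ha⟩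
        obtain ⟨a, ha, hE⟩ := this
        have hs : RIn G.WStep (· ∈ G.V) (G.W a) z.1 :=
          ⟨(hwf a ha).1, z.2, a, ha, rfl, hE⟩
        obtain ⟨t, h1, h2⟩ := ih ⟨G.W a, (hwf a ha).1⟩ (Relation.TransGen.single hs)
        exact ⟨t, h1, h2.tail hs⟩
  exact key ⟨z, hz⟩

/-- A westward walk whose vertices all satisfy `S` gives a semiwalk in `S`. -/
theorem reach_west (G : DGr) {S : ℕ → Prop} {t z : ℕ}
    (h : Relation.ReflTransGen (RIn G.WStep (· ∈ G.V)) t z)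
    (hS : ∀ u, Relation.ReflTransGen (RIn G.WStep (· ∈ G.V)) u z → S u) :
    Relation.ReflTransGen (RIn G.SStep S) z t := by
  induction h using Relation.ReflTransGen.head_induction_on with
  | refl => exact .refl
  | head h1 h2 ih =>
    refine ih.tail ⟨hS _ h2, hS _ (.head h1 h2), ?_⟩
    obtain ⟨_, _, a, ha, h⟩ := h1
    exact ⟨a, ha, Or.inr h⟩

end DGr

/-- **Lemma 4.1.4**: for distinct E-vertices `x`, `x′`, `y` of a D-graph, if
`v ≺ x`, `v ≺ x′`, `v ▷ [x,y]` and not `v ▷ [x,x′]`, then not `ψ_E(x,y,x′)`. -/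
theorem not_psi_of_pivot_separation (G : DGr) (hG : G.IsDGraph)
    (x x' y : ℕ)
    (hx : G.XVertex false x) (hx' : G.XVertex false x') (hy : G.XVertex false y)
    (hxx' : x ≠ x') (hxy : x ≠ y) (hx'y : x' ≠ y)
    (v : ℕ) (hvV : v ∈ G.V)
    (h1 : G.Pivot v x) (h2 : G.Pivot v x')
    (h3 : G.inAll v x y) (h4 : ¬ G.inAll v x x') :
    ¬ G.psi false x y x' := by
  obtain ⟨hwf, hac, _, hconn, _⟩ := hG
  intro hpsi
  unfold DGr.inAll at h4
  push Not at h4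
  obtain ⟨vs, es, hP, hvP⟩ := h4
  let S : ℕ → Prop := fun z => z ∈ G.V ∧ z ≠ v
  let C : ℕ → Prop := fun z => Relation.ReflTransGen (DGr.RIn G.SStep S) x z
  have hSx : S x := ⟨hx.1, h1.1.symm⟩
  have hCS : ∀ z, C z → S z := by
    intro z hz
    rcases Relation.ReflTransGen.cases_tail hz with h | ⟨_, _, h⟩
    · exact h ▸ hSx
    · exact h.2.1
  have hPC : ∀ z ∈ vs, C z := DGr.reach_of_semipath G hP
    (fun z hz => ⟨hP.1.1.2.1 z hz, fun h => hvP (h ▸ hz)⟩)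
  have hyC : ¬ C y := by
    intro h
    obtain ⟨vs', es', q1, q2⟩ := DGr.semipath_of_reach G (fun z hz => hz.1) (hCS y h) h
    exact (q2 v (h3 vs' es' q1)).2 rfl
  let D : ℕ → Prop := fun z => z ∈ G.V ∧ ¬ C z
  have hyv : Relation.ReflTransGen (DGr.RIn G.SStep D) y v := by
    have h0 : Relation.ReflTransGen (DGr.RIn G.SStep (· ∈ G.V)) y v := by
      by_cases e : y = v
      · rw [e]
      · obtain ⟨ws, fs, hq⟩ := hconn y hy.1 v hvV e
        exact DGr.reach_of_semipath G hq hq.1.1.2.1 v (List.mem_of_getLast? hq.2.2)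
    clear hpsi
    revert hyC
    clear h3 hxy hx'y hy
    induction h0 using Relation.ReflTransGen.head_induction_on with
    | refl => intro _; exact .refl
    | head k1 k2 ih =>
      rename_i a c
      intro ha
      by_cases e : a = v
      · rw [e]
      obtain ⟨Va, Vc, b, hb, hor⟩ := k1
      have hc : ¬ C c := by
        intro hc
        refine ha (Relation.ReflTransGen.tail hc ⟨hCS c hc, ⟨Va, e⟩, b, hb, ?_⟩)
        exact hor.symm
      exact .head ⟨⟨Va, ha⟩, ⟨Vc, hc⟩, b, hb, hor⟩ (ih hc)
  have hwest : ∀ z, Relation.ReflTransGen (DGr.RIn G.WStep (· ∈ G.V)) z v → D z := by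
    intro z hz
    refine ⟨?_, ?_⟩
    · rcases Relation.ReflTransGen.cases_head hz with h | ⟨_, h, _⟩
      · exact h ▸ hvV
      · exact h.1
    · intro hCz
      have hSz := hCS z hCz
      have hzv : Relation.TransGen (DGr.RIn G.WStep (· ∈ G.V)) z v := by
        rcases Relation.reflTransGen_iff_eq_or_transGen.1 hz with h | h
        · exact absurd h.symm hSz.2
        · exact h
      obtain ⟨t, ht, htz⟩ := DGr.exists_west G hwf hac z hSz.1
      have hall : ∀ u, Relation.ReflTransGen (DGr.RIn G.WStep (· ∈ G.V)) u z → S u := by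
        intro u hu
        have huv : Relation.TransGen (DGr.RIn G.WStep (· ∈ G.V)) u v := hzv.trans_right hu
        refine ⟨?_, ?_⟩
        · obtain ⟨_, h, _⟩ := Relation.TransGen.head'_iff.1 huv
          exact h.1
        · intro e
          exact DGr.no_closed G hac v (by rw [e] at huv; exact huv)
      have hxt : C t := Relation.ReflTransGen.trans hCz (DGr.reach_west G htz hall)
      obtain ⟨vs', es', q1, q2⟩ := DGr.semipath_of_reach G (fun z hz => hz.1) (hCS t hxt) hxt
      exact (q2 v (h1.2 t vs' es' ht q1)).2 rfl
  obtain ⟨t, ht, htv⟩ := DGr.exists_west G hwf hac v hvV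
  obtain ⟨vs', es', q1, q2⟩ := DGr.semipath_of_reach G (fun z hz => hz.1) (hwest t htv)
    (hyv.trans (DGr.reach_west G htv hwest))
  obtain ⟨z, z1, z2⟩ := hpsi vs es hP t vs' es' ht q1
  exact (q2 z z2).2 (hPC z z1)
end
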